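/- Let n ∈ ℕ with 3 ∤ n. Then H_{1,3}(n) = H_{2,3}(n), and this common value equals (3/4)·σ(n) − (1/2)·∑_{d∣n} min(d, n/d) if n ≡ 1 (mod 3), and equals (1/2)·σ(n) if n ≡ 2 (mod 3). -/

import Mathlib

open scoped BigOperators

namespace HurwitzPaper

/-- Evaluation of the binary quadratic form `(a,b,c)` (i.e. `a x² + b x y + c y²`). -/
def formEval (Q : ℤ × ℤ × ℤ) (x y : ℤ) : ℤ :=
  Q.1 * x ^ 2 + Q.2.1 * x * y + Q.2.2 * y ^ 2

/-- Discriminant `b² - 4ac` of the form `(a,b,c)`. -/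
def formDisc (Q : ℤ × ℤ × ℤ) : ℤ := Q.2.1 ^ 2 - 4 * Q.1 * Q.2.2

/-- Right action of `γ ∈ SL₂(ℤ)` on a binary quadratic form: `(Q∘γ)(x,y) = Q(ax+by, cx+dy)`. -/
def formAct (γ : Matrix.SpecialLinearGroup (Fin 2) ℤ) (Q : ℤ × ℤ × ℤ) : ℤ × ℤ × ℤ :=
  (formEval Q (γ.1 0 0) (γ.1 1 0),
   formEval Q (γ.1 0 0 + γ.1 0 1) (γ.1 1 0 + γ.1 1 1)
     - formEval Q (γ.1 0 0) (γ.1 1 0) - formEval Q (γ.1 0 1) (γ.1 1 1),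
   formEval Q (γ.1 0 1) (γ.1 1 1))

/-- A form is positive definite iff its leading coefficient is positive and its
discriminant is negative. -/
def IsPosDef (Q : ℤ × ℤ × ℤ) : Prop := 0 < Q.1 ∧ formDisc Q < 0

/-- `SL₂(ℤ)`-equivalence classes of positive definite integral binary quadratic forms
of discriminant `-N`. -/
abbrev FormClasses (N : ℤ) :=
  Quot (fun (Q Q' : {Q : ℤ × ℤ × ℤ // formDisc Q = -N ∧ IsPosDef Q}) =>
    ∃ γ : Matrix.SpecialLinearGroup (Fin 2) ℤ, formAct γ Q.1 = Q'.1)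

/-- The Hurwitz class number `H(N)`: each class of positive definite forms of
discriminant `-N` is counted with weight `1/ω_Q = 2/#Γ_Q`, where `Γ_Q` is the stabilizer
of (a representative of) the class in `SL₂(ℤ)`; `H(0) = -1/12`, and `H(N) = 0` when no
such forms exist (in particular for `N < 0` and `N ≡ 1, 2 (mod 4)`). -/
noncomputable def hurwitzClassNumber (N : ℤ) : ℝ :=
  if N = 0 then -(1 / 12)
  else ∑ᶠ c : FormClasses N,
    (2 : ℝ) / (Nat.card {γ : Matrix.SpecialLinearGroup (Fin 2) ℤ //
      formAct γ c.out.1 = c.out.1})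

/-- `H_{κ,m,M}(n) = ∑_{t ≡ m (mod M)} t^κ H(4n - t²)`. -/
noncomputable def HH (κ : ℕ) (m : ℤ) (M : ℕ) (n : ℕ) : ℝ :=
  ∑ᶠ t : ℤ, if t % (M : ℤ) = m % (M : ℤ) then
    (t : ℝ) ^ κ * hurwitzClassNumber (4 * n - t ^ 2) else 0

/-- `a(n)`: the `n`-th Fourier coefficient of `η(3τ)⁸ = q ∏_{k≥1} (1-q^{3k})⁸`
(the factors with `k > n` do not affect the coefficient of `q^n`). -/
noncomputable def etaCoeff (n : ℕ) : ℤ :=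
  Polynomial.coeff (Polynomial.X * ∏ k ∈ Finset.Icc 1 n, (1 - Polynomial.X ^ (3 * k)) ^ 8 : Polynomial ℤ) n




/-! ### sums over integer matrices -/

def ext4 (n : ℤ) (f : ℤ → ℤ → ℤ → ℤ → ℤ) (v : ℤ × ℤ × ℤ × ℤ) : ℤ :=
  if v.1 * v.2.2.2 + v.2.1 * v.2.2.1 = n then f v.1 v.2.1 v.2.2.1 v.2.2.2 else 0

noncomputable def Sm (n : ℤ) (f : ℤ → ℤ → ℤ → ℤ → ℤ) : ℤ := ∑ᶠ v, ext4 n f v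

def FS (n : ℤ) (f : ℤ → ℤ → ℤ → ℤ → ℤ) : Prop :=
  ∃ K : ℤ, ∀ a b c d, a * d + b * c = n → f a b c d ≠ 0 →
    |a| ≤ K ∧ |b| ≤ K ∧ |c| ≤ K ∧ |d| ≤ K

lemma FS.supp {n f} (h : FS n f) : (Function.support (ext4 n f)).Finite := by
  obtain ⟨K, hK⟩ := h
  refine Set.Finite.subset (((Set.finite_Icc (-K) K).prod ((Set.finite_Icc (-K) K).prod
    ((Set.finite_Icc (-K) K).prod (Set.finite_Icc (-K) K))))) ?_
  rintro ⟨a, b, c, d⟩ hv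
  simp only [Function.mem_support, ext4] at hv
  split_ifs at hv with h
  · have := hK a b c d h hv
    simp only [abs_le] at this
    simp only [Set.mem_prod, Set.mem_Icc]
    exact this
  · exact absurd rfl hv

lemma Sm_congr {n f g} (h : ∀ a b c d, a * d + b * c = n → f a b c d = g a b c d) :
    Sm n f = Sm n g := by
  unfold Sm
  congr 1
  ext ⟨a, b, c, d⟩
  simp only [ext4]
  split_ifs with h1
  · exact h _ _ _ _ h1
  · rfl

lemma FS.congr {n f g} (hf : FS n f) (h : ∀ a b c d, a * d + b * c = n → g a b c d = f a b c d) :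
    FS n g := by
  obtain ⟨K, hK⟩ := hf
  refine ⟨K, fun a b c d h1 h2 => hK a b c d h1 ?_⟩
  rwa [← h a b c d h1]

lemma FS.add {n f g} (hf : FS n f) (hg : FS n g) :
    FS n (fun a b c d => f a b c d + g a b c d) := by
  obtain ⟨K, hK⟩ := hf
  obtain ⟨L, hL⟩ := hg
  refine ⟨max K L, fun a b c d h1 h2 => ?_⟩
  by_cases h3 : f a b c d = 0
  · have := hL a b c d h1 (by simpa [h3] using h2)
    simp only [le_max_iff]; tauto
  · have := hK a b c d h1 h3
    simp only [le_max_iff]; tauto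

lemma FS.mul {n f} (φ : ℤ → ℤ → ℤ → ℤ → ℤ) (hf : FS n f) :
    FS n (fun a b c d => φ a b c d * f a b c d) := by
  obtain ⟨K, hK⟩ := hf
  exact ⟨K, fun a b c d h1 h2 => hK a b c d h1 (right_ne_zero_of_mul h2)⟩

lemma FS.neg {n f} (hf : FS n f) : FS n (fun a b c d => - f a b c d) := by
  obtain ⟨K, hK⟩ := hf
  exact ⟨K, fun a b c d h1 h2 => hK a b c d h1 (by simpa using h2)⟩

lemma FS.sub {n f g} (hf : FS n f) (hg : FS n g) :
    FS n (fun a b c d => f a b c d - g a b c d) :=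
  (hf.add hg.neg).congr (fun _ _ _ _ _ => by ring)

lemma Sm_add {n f g} (hf : FS n f) (hg : FS n g) :
    Sm n (fun a b c d => f a b c d + g a b c d) = Sm n f + Sm n g := by
  unfold Sm
  rw [← finsum_add_distrib hf.supp hg.supp]
  congr 1
  ext ⟨a, b, c, d⟩
  simp only [ext4]
  split_ifs <;> simp

lemma Sm_neg {n f} : Sm n (fun a b c d => - f a b c d) = - Sm n f := by
  unfold Sm
  rw [← finsum_neg_distrib]
  congr 1
  ext ⟨a, b, c, d⟩
  simp only [ext4]
  split_ifs <;> simp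

lemma Sm_sub {n f g} (hf : FS n f) (hg : FS n g) :
    Sm n (fun a b c d => f a b c d - g a b c d) = Sm n f - Sm n g := by
  rw [sub_eq_add_neg, ← Sm_neg, ← Sm_add hf hg.neg]
  exact Sm_congr (fun _ _ _ _ _ => by ring)

lemma Sm_mul {n f} (k : ℤ) (hf : FS n f) : Sm n (fun a b c d => k * f a b c d) = k * Sm n f := by
  unfold Sm
  rw [mul_finsum' _ _ hf.supp]
  congr 1
  ext ⟨a, b, c, d⟩
  simp only [ext4]
  split_ifs <;> simp

lemma Sm_equiv {n f g} (e : (ℤ × ℤ × ℤ × ℤ) ≃ (ℤ × ℤ × ℤ × ℤ))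
    (h : ∀ v, ext4 n f v = ext4 n g (e v)) : Sm n f = Sm n g := by
  unfold Sm
  rw [← finsum_comp_equiv e (f := ext4 n g)]
  exact finsum_congr h

def eS : (ℤ × ℤ × ℤ × ℤ) ≃ (ℤ × ℤ × ℤ × ℤ) where
  toFun v := (v.2.2.2, v.2.2.1, v.2.1, v.1)
  invFun v := (v.2.2.2, v.2.2.1, v.2.1, v.1)
  left_inv v := rfl
  right_inv v := rfl

def eU : (ℤ × ℤ × ℤ × ℤ) ≃ (ℤ × ℤ × ℤ × ℤ) where
  toFun v := (v.2.2.1 + v.2.2.2, v.2.2.1, v.2.1 + v.2.2.1 - v.1 + v.2.2.2, v.1 - v.2.2.1)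
  invFun v := (v.2.1 + v.2.2.2, v.2.1 + v.2.2.1 - v.1 + v.2.2.2, v.2.1, v.1 - v.2.1)
  left_inv v := by ext <;> simp <;> ring
  right_inv v := by ext <;> simp <;> ring

def eRS : (ℤ × ℤ × ℤ × ℤ) ≃ (ℤ × ℤ × ℤ × ℤ) where
  toFun v := (-v.2.1, v.1, v.2.2.2, -v.2.2.1)
  invFun v := (v.2.1, -v.1, -v.2.2.2, v.2.2.1)
  left_inv v := by simp
  right_inv v := by simp

def eRU : (ℤ × ℤ × ℤ × ℤ) ≃ (ℤ × ℤ × ℤ × ℤ) where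
  toFun v := (v.2.1, v.2.1 - v.1, -v.2.2.2, v.2.2.1 + v.2.2.2)
  invFun v := (v.1 - v.2.1, v.1, v.2.2.2 + v.2.2.1, -v.2.2.1)
  left_inv v := by ext <;> simp
  right_inv v := by ext <;> simp

lemma Sm_S (n f) : Sm n (fun a b c d => f d c b a) = Sm n f :=
  Sm_equiv eS (by
    rintro ⟨a, b, c, d⟩; simp only [ext4, eS, Equiv.coe_fn_mk]
    exact if_congr (by constructor <;> intro h <;> linarith) rfl rfl)

lemma Sm_U (n f) : Sm n (fun a b c d => f (c + d) c (b + c - a + d) (a - c)) = Sm n f :=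
  Sm_equiv eU (by
    rintro ⟨a, b, c, d⟩; simp only [ext4, eU, Equiv.coe_fn_mk]
    exact if_congr (by constructor <;> intro h <;> linarith) rfl rfl)

lemma Sm_U2 (n f) : Sm n (fun a b c d => f (b + d) (b + c - a + d) b (a - b)) = Sm n f :=
  Sm_equiv eU.symm (by
    rintro ⟨a, b, c, d⟩; simp only [ext4, eU, Equiv.coe_fn_symm_mk]
    exact if_congr (by constructor <;> intro h <;> linarith) rfl rfl)

lemma Sm_RS (n f) : Sm n (fun a b c d => f (-b) a d (-c)) = Sm n f :=
  Sm_equiv eRS (by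
    rintro ⟨a, b, c, d⟩; simp only [ext4, eRS, Equiv.coe_fn_mk]
    exact if_congr (by constructor <;> intro h <;> linarith) rfl rfl)

lemma Sm_RU (n f) : Sm n (fun a b c d => f b (b - a) (-d) (c + d)) = Sm n f :=
  Sm_equiv eRU (by
    rintro ⟨a, b, c, d⟩; simp only [ext4, eRU, Equiv.coe_fn_mk]
    exact if_congr (by constructor <;> intro h <;> linarith) rfl rfl)

lemma FS.S {n f} (h : FS n f) : FS n (fun a b c d => f d c b a) := by
  obtain ⟨K, hK⟩ := h
  refine ⟨K, fun a b c d h1 h2 => ?_⟩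
  have := hK d c b a (by linarith) h2
  tauto

lemma FS.U {n f} (h : FS n f) :
    FS n (fun a b c d => f (c + d) c (b + c - a + d) (a - c)) := by
  obtain ⟨K, hK⟩ := h
  refine ⟨4 * K, fun a b c d h1 h2 => ?_⟩
  have := hK _ _ _ _ (by linarith) h2
  simp only [abs_le] at *
  omega

lemma FS.U2 {n f} (h : FS n f) :
    FS n (fun a b c d => f (b + d) (b + c - a + d) b (a - b)) := by
  obtain ⟨K, hK⟩ := h
  refine ⟨4 * K, fun a b c d h1 h2 => ?_⟩
  have := hK _ _ _ _ (by linarith) h2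
  simp only [abs_le] at *
  omega

lemma FS.RU {n f} (h : FS n f) :
    FS n (fun a b c d => f b (b - a) (-d) (c + d)) := by
  obtain ⟨K, hK⟩ := h
  refine ⟨4 * K, fun a b c d h1 h2 => ?_⟩
  have := hK _ _ _ _ (by linarith) h2
  simp only [abs_le] at *
  omega


/-! ### the sign functions -/

def rho (a b c d : ℤ) : ℤ :=
  if 0 < b * c then ((a - d) * c).sign else ((a + d) * (c - b)).sign
def sI (a b c d : ℤ) : ℤ := if a * c = 0 then (-(b * d)).sign else (a * c).sign
def sO (a b c d : ℤ) : ℤ := if b * d = 0 then (a * c).sign else (-(b * d)).sign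
def sP (a b c d : ℤ) : ℤ :=
  if (a - b) * (c + d) = 0 then (b * c - a * d).sign else ((a - b) * (c + d)).sign
def sN (a b c d : ℤ) : ℤ :=
  if (a + b) * (c - d) = 0 then (a * d - b * c).sign else ((a + b) * (c - d)).sign

lemma sg_neg' (x : ℤ) : (-x).sign = - x.sign := Int.sign_neg x

lemma rho_S (a b c d : ℤ) : rho d c b a = - rho a b c d := by
  unfold rho
  rw [mul_comm c b]
  split_ifs with h
  · have : b.sign = c.sign := by
      rcases pos_and_pos_or_neg_and_neg_of_mul_pos h with ⟨h1, h2⟩ | ⟨h1, h2⟩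
      · rw [Int.sign_eq_one_of_pos h1, Int.sign_eq_one_of_pos h2]
      · rw [Int.sign_eq_neg_one_of_neg h1, Int.sign_eq_neg_one_of_neg h2]
    rw [Int.sign_mul, Int.sign_mul, this, ← neg_sub, sg_neg', neg_mul]
  · rw [← sg_neg']; congr 1; ring

lemma sO_eq (a b c d : ℤ) : sO a b c d = - sI d c b a := by
  unfold sO sI
  rw [mul_comm d b, mul_comm c a]
  split_ifs
  · rw [sg_neg']; ring
  · rw [sg_neg']

lemma sN_eq (a b c d : ℤ) : sN a b c d = - sP d c b a := by
  unfold sN sP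
  have h : (d - c) * (b + a) = - ((a + b) * (c - d)) := by ring
  have h' : c * b - d * a = -(a * d - b * c) := by ring
  rw [h, h']
  simp only [neg_eq_zero]
  split_ifs <;> rw [sg_neg', neg_neg]

lemma sP_RS (a b c d : ℤ) : sP (-b) a d (-c) = sN a b c d := by
  unfold sN sP
  have h : (-b - a) * (d + -c) = ((a + b) * (c - d)) := by ring
  have h' : a * d - -b * -c = (a * d - b * c) := by ring
  rw [h, h']

lemma sN_RS (a b c d : ℤ) : sN (-b) a d (-c) = sP a b c d := by
  unfold sN sP
  have h : (-b + a) * (d - -c) = ((a - b) * (c + d)) := by ring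
  have h' : -b * -c - a * d  = (b * c - a * d) := by ring
  rw [h, h']

lemma rho_neg (a b c d : ℤ) : rho (-a) (-b) (-c) (-d) = rho a b c d := by
  unfold rho
  rw [show -b * -c = b * c by ring, show (-a - -d) * -c = (a - d) * c by ring,
    show (-a + -d) * (-c - -b) = (a + d) * (c - b) by ring]

lemma sP_neg (a b c d : ℤ) : sP (-a) (-b) (-c) (-d) = sP a b c d := by
  unfold sP
  rw [show -b * -c - -a * -d = b * c - a * d by ring, show (-a - -b) * (-c + -d) = (a - b) * (c + d) by ring]

lemma rho_eq {a b c d e : ℤ} (h1 : 0 < b * c → 0 < (a-d)*c * e) (h2 : b * c ≤ 0 → 0 < (a+d)*(c-b)*e) :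
    rho a b c d = e.sign := by
  have key : ∀ x : ℤ, 0 < x * e → x.sign = e.sign := by
    intro x hx
    rcases pos_and_pos_or_neg_and_neg_of_mul_pos hx with ⟨h1, h2⟩ | ⟨h1, h2⟩
    · rw [Int.sign_eq_one_of_pos h1, Int.sign_eq_one_of_pos h2]
    · rw [Int.sign_eq_neg_one_of_neg h1, Int.sign_eq_neg_one_of_neg h2]
  unfold rho
  split_ifs with h
  · exact key _ (h1 h)
  · exact key _ (h2 (not_lt.mp h))

lemma sgn3 (x : ℤ) : (0 < x ∧ x.sign = 1) ∨ (x = 0 ∧ x.sign = 0) ∨ (x < 0 ∧ x.sign = -1) := by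
  rcases lt_trichotomy x 0 with h | h | h
  · exact Or.inr (Or.inr ⟨h, Int.sign_eq_neg_one_of_neg h⟩)
  · subst h; simp
  · exact Or.inl ⟨h, Int.sign_eq_one_of_pos h⟩

lemma bd4 {n a b c d : ℤ} (h : a * d + b * c = n) (h1 : 0 < a * d) (h2 : 0 < b * c) :
    |a| ≤ n ∧ |b| ≤ n ∧ |c| ≤ n ∧ |d| ≤ n := by
  have key : ∀ x y : ℤ, 0 < x * y → |x| ≤ x * y := by
    intro x y hxy
    rcases pos_and_pos_or_neg_and_neg_of_mul_pos hxy with ⟨h1, h2⟩ | ⟨h1, h2⟩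
    · rw [abs_of_pos h1]; nlinarith
    · rw [abs_of_neg h1]; nlinarith
  have e1 := key a d h1
  have e2 := key d a (by linarith)
  have e3 := key b c h2
  have e4 := key c b (by linarith)
  refine ⟨?_, ?_, ?_, ?_⟩ <;> linarith

/-- rho = sI unless ad>0 and bc>0 -/
lemma HI_zero {n a b c d : ℤ} (hn : 0 < n) (h : a * d + b * c = n) (h2 : a * d ≤ 0 ∨ b * c ≤ 0) :
    rho a b c d = sI a b c d := by
  unfold rho sI
  by_cases hbc : 0 < b * c
  · have had : a * d ≤ 0 := by rcases h2 with h2 | h2 <;> linarith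
    have hc : c ≠ 0 := by rintro rfl; simp at hbc
    have hb : b ≠ 0 := by rintro rfl; simp at hbc
    rw [if_pos hbc]
    have hs : b.sign = c.sign := by
      rcases pos_and_pos_or_neg_and_neg_of_mul_pos hbc with ⟨h1, h2⟩ | ⟨h1, h2⟩
      · rw [Int.sign_eq_one_of_pos h1, Int.sign_eq_one_of_pos h2]
      · rw [Int.sign_eq_neg_one_of_neg h1, Int.sign_eq_neg_one_of_neg h2]
    rcases sgn3 a with ⟨ha, ha'⟩ | ⟨ha, ha'⟩ | ⟨ha, ha'⟩
    · have : d ≤ 0 := by nlinarith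
      rw [if_neg (by positivity), Int.sign_mul, Int.sign_mul, ha',
        Int.sign_eq_one_of_pos (by linarith)]
    · subst ha
      simp [Int.sign_mul, hs, mul_comm]
    · have : 0 ≤ d := by nlinarith
      rw [if_neg (mul_ne_zero ha.ne hc), Int.sign_mul, Int.sign_mul, ha',
        Int.sign_eq_neg_one_of_neg (by linarith)]
  · rw [if_neg hbc]
    have had : 0 < a * d := by linarith
    have hac : a ≠ 0 := by rintro rfl; simp at had
    have key : (a + d).sign = a.sign ∧ d.sign = a.sign := by
      rcases pos_and_pos_or_neg_and_neg_of_mul_pos had with ⟨h1, h2⟩ | ⟨h1, h2⟩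
      · rw [Int.sign_eq_one_of_pos h1, Int.sign_eq_one_of_pos h2, Int.sign_eq_one_of_pos (by linarith)]
        simp
      · rw [Int.sign_eq_neg_one_of_neg h1, Int.sign_eq_neg_one_of_neg h2, Int.sign_eq_neg_one_of_neg (by linarith)]
        simp
    rcases sgn3 c with ⟨hc, hc'⟩ | ⟨hc, hc'⟩ | ⟨hc, hc'⟩
    · have : b ≤ 0 := by nlinarith
      rw [if_neg (mul_ne_zero hac hc.ne'), Int.sign_mul, Int.sign_mul, key.1, hc',
        Int.sign_eq_one_of_pos (show 0 < c - b by linarith)]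
    · subst hc
      simp [Int.sign_mul, key.1, key.2, mul_comm]
    · have : 0 ≤ b := by nlinarith
      rw [if_neg (mul_ne_zero hac hc.ne), Int.sign_mul, Int.sign_mul, key.1, hc',
        Int.sign_eq_neg_one_of_neg (show c - b < 0 by linarith)]

lemma FS_HI {n : ℤ} (hn : 0 < n) : FS n (fun a b c d => rho a b c d - sI a b c d) := by
  refine ⟨n, fun a b c d h h' => ?_⟩
  by_contra h2
  apply h'
  rw [sub_eq_zero]
  apply HI_zero hn h
  by_contra h3
  push Not at h3
  exact h2 (bd4 h h3.1 h3.2)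

/-- the same for sP; case ad>0, positive a, d, and case bc>0 -/
lemma HP_aux1 {n a b c d : ℤ} (hn : 0 < n) (h : a * d + b * c = n) (hbc : b * c ≤ 0)
    (ha : 0 < a) (hd : 0 < d) (hne : rho a b c d ≠ sP a b c d) :
    |a| ≤ n ∧ |b| ≤ n ∧ |c| ≤ n ∧ |d| ≤ n := by
  unfold rho at hne
  rw [if_neg (not_lt.mpr hbc), Int.sign_mul, Int.sign_eq_one_of_pos (show 0 < a + d by linarith),
    one_mul] at hne
  unfold sP at hne
  rcases lt_trichotomy c b with hcb | hcb | hcb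
  · rw [Int.sign_eq_neg_one_of_neg (by linarith)] at hne
    have hc : c ≤ 0 := by nlinarith
    have hb : 0 ≤ b := by nlinarith
    split_ifs at hne with h0
    · exact absurd (Int.sign_eq_neg_one_of_neg (by nlinarith)).symm hne
    · rcases lt_or_gt_of_ne h0 with h1 | h1
      · exact absurd (Int.sign_eq_neg_one_of_neg h1).symm hne
      · rcases pos_and_pos_or_neg_and_neg_of_mul_pos h1 with ⟨h2, h3⟩ | ⟨h2, h3⟩
        · rw [abs_of_pos ha, abs_of_pos hd, abs_of_nonneg hb, abs_of_nonpos hc]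
          have : a + d ≤ n + 1 := by
            have : b * (-c) ≤ (a - 1) * (d - 1) :=
              mul_le_mul (by linarith) (by linarith) (by linarith) (by linarith)
            nlinarith
          refine ⟨?_, ?_, ?_, ?_⟩ <;> linarith
        · exfalso
          have : a * d ≤ b * (-c) := mul_le_mul (by linarith) (by linarith) (by linarith) (by linarith)
          linarith
  · subst hcb
    have : c = 0 := by nlinarith [sq_nonneg c]
    subst this
    simp only [mul_zero, add_zero, abs_zero, abs_of_pos ha, abs_of_pos hd] at *
    refine ⟨?_, ?_, ?_, ?_⟩ <;> nlinarith
  · exfalso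
    have hc : 0 ≤ c := by nlinarith
    have hb : b ≤ 0 := by nlinarith
    have : 0 < (a - b) * (c + d) := mul_pos (by linarith) (by linarith)
    rw [if_neg this.ne', Int.sign_eq_one_of_pos this, Int.sign_eq_one_of_pos (by linarith)] at hne
    exact hne rfl

lemma HP_aux2 {n a b c d : ℤ} (hn : 0 < n) (h : a * d + b * c = n) (had : a * d ≤ 0)
    (hb : 0 < b) (hc : 0 < c) (hne : rho a b c d ≠ sP a b c d) :
    |a| ≤ n ∧ |b| ≤ n ∧ |c| ≤ n ∧ |d| ≤ n := by
  unfold rho at hne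
  rw [if_pos (mul_pos hb hc), Int.sign_mul, Int.sign_eq_one_of_pos hc, mul_one] at hne
  unfold sP at hne
  rcases lt_trichotomy d a with hcb | hcb | hcb
  · rw [Int.sign_eq_one_of_pos (by linarith)] at hne
    have hd : d ≤ 0 := by nlinarith
    have ha : 0 ≤ a := by nlinarith
    split_ifs at hne with h0
    · exact absurd (Int.sign_eq_one_of_pos (by nlinarith)).symm hne
    · rcases lt_or_gt_of_ne h0 with h1 | h1
      · rcases mul_neg_iff.mp h1 with ⟨h2, h3⟩ | ⟨h2, h3⟩
        · exfalso
          have : b * c ≤ a * (-d) := mul_le_mul (by linarith) (by linarith) (by linarith) (by linarith)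
          linarith
        · rw [abs_of_nonneg ha, abs_of_nonpos hd, abs_of_pos hb, abs_of_pos hc]
          have : b + c ≤ n + 1 := by
            have : a * (-d) ≤ (b - 1) * (c - 1) :=
              mul_le_mul (by linarith) (by linarith) (by linarith) (by linarith)
            nlinarith
          refine ⟨?_, ?_, ?_, ?_⟩ <;> linarith
      · exact absurd (Int.sign_eq_one_of_pos h1).symm hne
  · subst hcb
    have : d = 0 := by nlinarith [sq_nonneg d]
    subst this
    simp only [mul_zero, zero_add, abs_zero, abs_of_pos hb, abs_of_pos hc] at *
    refine ⟨?_, ?_, ?_, ?_⟩ <;> nlinarith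
  · exfalso
    have hd : 0 ≤ d := by nlinarith
    have ha : a ≤ 0 := by nlinarith
    have : (a - b) * (c + d) < 0 := mul_neg_of_neg_of_pos (by linarith) (by linarith)
    rw [if_neg this.ne, Int.sign_eq_neg_one_of_neg this, Int.sign_eq_neg_one_of_neg (by linarith)] at hne
    exact hne rfl

lemma FS_HP {n : ℤ} (hn : 0 < n) : FS n (fun a b c d => rho a b c d - sP a b c d) := by
  refine ⟨n, fun a b c d h h' => ?_⟩
  have hne : rho a b c d ≠ sP a b c d := fun e => h' (by simp only [e, sub_self])
  have hne' : rho (-a) (-b) (-c) (-d) ≠ sP (-a) (-b) (-c) (-d) := by rwa [rho_neg, sP_neg]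
  have h'' : (-a) * (-d) + (-b) * (-c) = n := by linarith
  rcases le_or_gt (b * c) 0 with h1 | h1
  · have had : 0 < a * d := by linarith
    rcases pos_and_pos_or_neg_and_neg_of_mul_pos had with ⟨h2, h3⟩ | ⟨h2, h3⟩
    · exact HP_aux1 hn h h1 h2 h3 hne
    · simpa using HP_aux1 hn h'' (by linarith) (by linarith) (by linarith) hne'
  · rcases le_or_gt (a * d) 0 with h2 | h2
    · rcases pos_and_pos_or_neg_and_neg_of_mul_pos h1 with ⟨h3, h4⟩ | ⟨h3, h4⟩
      · exact HP_aux2 hn h h2 h3 h4 hne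
      · simpa using HP_aux2 hn h'' (by linarith) (by linarith) (by linarith) hne'
    · exact bd4 h h2 h1

lemma FS_HO {n : ℤ} (hn : 0 < n) : FS n (fun a b c d => rho a b c d - sO a b c d) :=
  (FS_HI hn).S.neg.congr (fun a b c d _ => by
    have := rho_S a b c d
    have := sO_eq a b c d
    linarith)

lemma FS_HN {n : ℤ} (hn : 0 < n) : FS n (fun a b c d => rho a b c d - sN a b c d) :=
  (FS_HP hn).S.neg.congr (fun a b c d _ => by
    have := rho_S a b c d
    have := sN_eq a b c d
    linarith)


def root2 (a b c d : ℤ) : ℤ :=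
  rho a b c d + rho (c + d) c (b + c - a + d) (a - c) + rho (b + d) (b + c - a + d) b (a - b) - 1

def EI (a b c d : ℤ) : ℤ :=
  sI a b c d + sO (c + d) c (b + c - a + d) (a - c) + sP (b + d) (b + c - a + d) b (a - b) - 1

def EN (a b c d : ℤ) : ℤ :=
  sN a b c d + sN (c + d) c (b + c - a + d) (a - c) + sN (b + d) (b + c - a + d) b (a - b) - 1

def HI (a b c d : ℤ) : ℤ := rho a b c d - sI a b c d
def HO (a b c d : ℤ) : ℤ := rho a b c d - sO a b c d
def HP (a b c d : ℤ) : ℤ := rho a b c d - sP a b c d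
def HN (a b c d : ℤ) : ℤ := rho a b c d - sN a b c d

lemma HO_eq (a b c d : ℤ) : HO a b c d = - HI d c b a := by
  have := rho_S a b c d
  have := sO_eq a b c d
  unfold HO HI; linarith

lemma HN_eq (a b c d : ℤ) : HN a b c d = - HP d c b a := by
  have := rho_S a b c d
  have := sN_eq a b c d
  unfold HN HP; linarith

lemma root2_U (a b c d : ℤ) : root2 (c + d) c (b + c - a + d) (a - c) = root2 a b c d := by
  unfold root2
  rw [show b + c - a + d + (a - c) = b + d by ring,
    show c + (b + c - a + d) - (c + d) + (a - c) = b by ring,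
    show c + d - (b + c - a + d) = a - b by ring,
    show c + (a - c) = a by ring, show c + d - c = d by ring]
  ring

lemma root2_decI (a b c d : ℤ) : root2 a b c d = HI a b c d
    + HO (c + d) c (b + c - a + d) (a - c) + HP (b + d) (b + c - a + d) b (a - b) + EI a b c d := by
  unfold root2 HI HO HP EI; ring

lemma root2_decN (a b c d : ℤ) : root2 a b c d = HN a b c d
    + HN (c + d) c (b + c - a + d) (a - c) + HN (b + d) (b + c - a + d) b (a - b) + EN a b c d := by
  unfold root2 HN EN; ring

lemma EI_gen {a b c d : ℤ} (ha : a ≠ 0) (hc : c ≠ 0) (hac : a ≠ c) : EI a b c d = 0 := by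
  have hac' : a - c ≠ 0 := sub_ne_zero.mpr hac
  unfold EI sI sO sP
  rw [if_neg (mul_ne_zero ha hc), if_neg (mul_ne_zero hc hac'),
    show (b + d - (b + c - a + d)) * (b + (a - b)) = (a - c) * a by ring,
    if_neg (mul_ne_zero hac' ha)]
  simp only [sg_neg', Int.sign_mul]
  rcases sgn3 a with ⟨h1, h1'⟩ | ⟨h1, h1'⟩ | ⟨h1, h1'⟩ <;>
  rcases sgn3 c with ⟨h2, h2'⟩ | ⟨h2, h2'⟩ | ⟨h2, h2'⟩ <;>
  rcases sgn3 (a - c) with ⟨h3, h3'⟩ | ⟨h3, h3'⟩ | ⟨h3, h3'⟩ <;>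
  first
  | (exfalso; omega)
  | (rw [h1', h2', h3']; norm_num)

lemma EI_c {a b d : ℤ} (ha : a ≠ 0) :
    EI a b 0 d = (d * (b - a + d)).sign - (b * d).sign := by
  unfold EI sI sO sP
  rw [show (b + d - (b + 0 - a + d)) * (b + (a - b)) = a * a by ring,
    if_neg (mul_ne_zero ha ha), Int.sign_eq_one_of_pos (mul_self_pos.mpr ha)]
  simp only [mul_zero, zero_mul, if_true, sg_neg', zero_add, add_zero]
  ring

lemma EI_a {b c d : ℤ} (hc : c ≠ 0) :
    EI 0 b c d = (b * (2 * b + c + 2 * d)).sign - (b * d).sign := by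
  unfold EI sI sO sP
  rw [show (b + d - (b + c - 0 + d)) * (b + (0 - b)) = 0 by ring,
    if_neg (mul_ne_zero hc (by simpa using hc)),
    show -(c * (0 - c)) = c * c by ring, Int.sign_eq_one_of_pos (mul_self_pos.mpr hc),
    show (b + c - 0 + d) * b - (b + d) * (0 - b) = b * (2 * b + c + 2 * d) by ring]
  simp only [zero_mul, if_true, sg_neg']
  ring

lemma EI_ac {a b d : ℤ} (ha : a ≠ 0) :
    EI a b a d = ((b + d) * (a + d)).sign + ((b + d) * (2 * b - a)).sign := by
  unfold EI sI sO sP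
  rw [show (b + d - (b + a - a + d)) * (b + (a - b)) = 0 by ring,
    if_neg (mul_ne_zero ha ha), Int.sign_eq_one_of_pos (mul_self_pos.mpr ha),
    if_pos (by ring), if_pos rfl,
    show (b + a - a + d) * b - (b + d) * (a - b) = (b + d) * (2 * b - a) by ring,
    show (a + d) * (b + a - a + d) = (b + d) * (a + d) by ring]
  ring

lemma sgn_diff {x y : ℤ} (h : x.sign - y.sign ≠ 0) : |y| ≤ |x - y| := by
  rcases sgn3 x with ⟨h1, h1'⟩ | ⟨h1, h1'⟩ | ⟨h1, h1'⟩ <;>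
  rcases sgn3 y with ⟨h2, h2'⟩ | ⟨h2, h2'⟩ | ⟨h2, h2'⟩ <;>
  rw [h1', h2'] at h <;> simp at h <;>
  rcases abs_cases y with ⟨h3, h4⟩ | ⟨h3, h4⟩ <;>
  rcases abs_cases (x - y) with ⟨h5, h6⟩ | ⟨h5, h6⟩ <;> omega

lemma div_bd {n a d : ℤ} (hn : 0 < n) (h : a * d = n) : |a| ≤ n ∧ |d| ≤ n := by
  have : |a| * |d| = n := by rw [← abs_mul, h, abs_of_pos hn]
  have h1 : 0 < |a| := abs_pos.mpr (by rintro rfl; simp at h; omega)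
  have h2 : 0 < |d| := abs_pos.mpr (by rintro rfl; simp at h; omega)
  constructor <;> nlinarith

lemma FS_EI {n : ℤ} (hn : 0 < n) : FS n EI := by
  refine ⟨10 * n, fun a b c d h h' => ?_⟩
  by_cases hc : c = 0
  · subst hc
    have had : a * d = n := by linarith
    have ha : a ≠ 0 := by rintro rfl; simp at had; omega
    rw [EI_c ha] at h'
    have hbd := div_bd hn had
    have hd : d.sign ≠ 0 := by intro h; rw [Int.sign_eq_zero_iff_zero] at h; subst h; simp at had; omega
    rw [Int.sign_mul, mul_comm b, Int.sign_mul, ← mul_sub] at h'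
    have := sgn_diff (right_ne_zero_of_mul h')
    rw [show b - a + d - b = d - a by ring] at this
    rw [abs_le] at hbd
    have := abs_le.mp (this.trans (b := |d - a|) (c := 2 * n) (abs_le.mpr (by
      have := abs_le.mp hbd.2; omega)))
    rw [abs_le] at hbd
    simp only [abs_le]
    omega
  · by_cases ha : a = 0
    · subst ha
      have hbc : b * c = n := by linarith
      rw [EI_a hc] at h'
      have hbd := div_bd hn hbc
      rw [Int.sign_mul, Int.sign_mul, ← mul_sub] at h'
      have := right_ne_zero_of_mul h'
      rcases sgn3 (2 * b + c + 2 * d) with ⟨h1, h1'⟩ | ⟨h1, h1'⟩ | ⟨h1, h1'⟩ <;>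
      rcases sgn3 d with ⟨h2, h2'⟩ | ⟨h2, h2'⟩ | ⟨h2, h2'⟩ <;>
      rw [h1', h2'] at this <;> simp at this <;> simp only [abs_le] at * <;> omega
    · by_cases hac : a = c
      · subst hac
        have hbc : a * (b + d) = n := by linarith
        rw [EI_ac ha] at h'
        have hbd := div_bd hn hbc
        rw [Int.sign_mul, Int.sign_mul, ← mul_add] at h'
        have := right_ne_zero_of_mul h'
        rcases sgn3 (a + d) with ⟨h1, h1'⟩ | ⟨h1, h1'⟩ | ⟨h1, h1'⟩ <;>
        rcases sgn3 (2 * b - a) with ⟨h2, h2'⟩ | ⟨h2, h2'⟩ | ⟨h2, h2'⟩ <;>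
        rw [h1', h2'] at this <;> simp at this <;> simp only [abs_le] at * <;> omega
      · exact absurd (EI_gen ha hc hac) h'

lemma FS_root2 {n : ℤ} (hn : 0 < n) : FS n root2 :=
  ((((FS_HI hn).add (FS_HO hn).U).add (FS_HP hn).U2).add (FS_EI hn)).congr
    (fun a b c d _ => root2_decI a b c d)

lemma FS_EN {n : ℤ} (hn : 0 < n) : FS n EN :=
  ((((FS_root2 hn).sub (FS_HN hn)).sub (FS_HN hn).U).sub (FS_HN hn).U2).congr
    (fun a b c d _ => by have := root2_decN a b c d; simp only [HN] at this; linarith)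

/-- First main identity. -/
theorem T1 {n : ℤ} (hn : 0 < n) (φ : ℤ → ℤ → ℤ → ℤ → ℤ)
    (hS : ∀ a b c d, a * d + b * c = n → φ d c b a = φ a b c d)
    (hU : ∀ a b c d, a * d + b * c = n → φ (c + d) c (b + c - a + d) (a - c) = φ a b c d)
    (hRS : ∀ a b c d, a * d + b * c = n → φ (-b) a d (-c) = φ a b c d) :
    Sm n (fun a b c d => φ a b c d * root2 a b c d) =
      Sm n (fun a b c d => φ a b c d * EI a b c d) := by
  have hU2 : ∀ a b c d, a * d + b * c = n →
      φ (b + d) (b + c - a + d) b (a - b) = φ a b c d := by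
    intro a b c d h
    rw [← hU _ _ _ _ h, ← hU _ _ _ _ (show (c + d) * (a - c) + c * (b + c - a + d) = n by linarith)]
    congr 1 <;> ring
  have fI := FS.mul φ (f := HI) (FS_HI hn)
  have fO := FS.mul φ (f := HO) (FS_HO hn)
  have fP := FS.mul φ (f := HP) (FS_HP hn)
  have fN := FS.mul φ (f := HN) (FS_HN hn)
  have fE := FS.mul φ (FS_EI hn)
  have e1 : Sm n (fun a b c d => φ a b c d * root2 a b c d) =
      Sm n (fun a b c d => φ a b c d * HI a b c d) + Sm n (fun a b c d => φ a b c d * HO a b c d)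
      + Sm n (fun a b c d => φ a b c d * HP a b c d) + Sm n (fun a b c d => φ a b c d * EI a b c d) := by
    rw [← Sm_U n (fun a b c d => φ a b c d * HO a b c d),
      ← Sm_U2 n (fun a b c d => φ a b c d * HP a b c d),
      ← Sm_add fI fO.U, ← Sm_add (fI.add fO.U) fP.U2, ← Sm_add ((fI.add fO.U).add fP.U2) fE]
    apply Sm_congr
    intro a b c d h
    rw [root2_decI, hU _ _ _ _ h, hU2 _ _ _ _ h]
    ring
  have e2 : Sm n (fun a b c d => φ a b c d * HO a b c d) =
      - Sm n (fun a b c d => φ a b c d * HI a b c d) := by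
    rw [← Sm_neg, ← Sm_S]
    apply Sm_congr
    intro a b c d h
    rw [hS _ _ _ _ h, HO_eq]; ring
  have e3 : Sm n (fun a b c d => φ a b c d * HN a b c d) =
      - Sm n (fun a b c d => φ a b c d * HP a b c d) := by
    rw [← Sm_neg, ← Sm_S]
    apply Sm_congr
    intro a b c d h
    rw [hS _ _ _ _ h, HN_eq]; ring
  have e4 : Sm n (fun a b c d => φ a b c d * HP a b c d - φ a b c d * HN a b c d) =
      - Sm n (fun a b c d => φ a b c d * HP a b c d - φ a b c d * HN a b c d) := by
    rw [← Sm_neg, ← Sm_RS]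
    apply Sm_congr
    intro a b c d h
    simp only [HP, HN, hRS _ _ _ _ h, sP_RS, sN_RS]; ring
  rw [Sm_sub fP fN] at e4
  linarith

def dI (_ _ c _ : ℤ) : ℤ := if (c : ZMod 3) = 0 then 1 else 0
def dO (_ b _ _ : ℤ) : ℤ := if (b : ZMod 3) = 0 then 1 else 0
def dP (a b c d : ℤ) : ℤ := if (a - b - c - d : ZMod 3) = 0 then 1 else 0
def dN (a b c d : ℤ) : ℤ := if (a + b + c - d : ZMod 3) = 0 then 1 else 0

lemma tri {x y : ℤ} (hx : x ≠ 0) (hy : y ≠ 0) (hxy : y - x ≠ 0) :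
    (x * y).sign + (y * (y - x)).sign - (x * (y - x)).sign = 1 := by
  simp only [Int.sign_mul]
  rcases sgn3 x with ⟨h1, h1'⟩ | ⟨h1, h1'⟩ | ⟨h1, h1'⟩ <;>
  rcases sgn3 y with ⟨h2, h2'⟩ | ⟨h2, h2'⟩ | ⟨h2, h2'⟩ <;>
  rcases sgn3 (y - x) with ⟨h3, h3'⟩ | ⟨h3, h3'⟩ | ⟨h3, h3'⟩ <;>
  first
  | (exfalso; omega)
  | (rw [h1', h2', h3']; norm_num)

lemma ne_zero_of_zmod {x : ℤ} (h : (x : ZMod 3) ≠ 0) : x ≠ 0 := by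
  rintro rfl; simp at h

lemma sN_of_ne {a b c d : ℤ} {x y : ℤ} (hx : a + b = x) (hy : c - d = y) (h : x ≠ 0) (h' : y ≠ 0) :
    sN a b c d = (x * y).sign := by
  unfold sN
  rw [hx, hy, if_neg (mul_ne_zero h h')]

lemma EN_val {n a b c d : ℤ} (hn : (n : ZMod 3) ≠ 0) (h : a * d + b * c = n)
    (hd : (a + b + c - d : ZMod 3) = 0) :
    EN a b c d = ((a + b) * (c - d)).sign + ((2 * c + d) * (b + 2 * c - 2 * a + d)).sign
      + ((2 * b + c - a + 2 * d) * (2 * b - a)).sign - 1 ∧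
    a + b ≠ 0 ∧ c - d ≠ 0 ∧ 2 * c + d ≠ 0 ∧ b + 2 * c - 2 * a + d ≠ 0 ∧
    2 * b + c - a + 2 * d ≠ 0 ∧ 2 * b - a ≠ 0 := by
  have hz : (a * d + b * c : ZMod 3) ≠ 0 := by rw [← h] at hn; push_cast at hn; exact hn
  have key : ∀ a b c d : ZMod 3, a * d + b * c ≠ 0 → a + b + c - d = 0 →
    a + b ≠ 0 ∧ c - d ≠ 0 ∧ 2 * c + d ≠ 0 ∧ b + 2 * c - 2 * a + d ≠ 0 ∧
    2 * b + c - a + 2 * d ≠ 0 ∧ 2 * b - a ≠ 0 := by decide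
  obtain ⟨k1, k2, k3, k4, k5, k6⟩ := key a b c d hz hd
  have l1 : a + b ≠ 0 := ne_zero_of_zmod (by push_cast; exact k1)
  have l2 : c - d ≠ 0 := ne_zero_of_zmod (by push_cast; exact k2)
  have l3 : 2 * c + d ≠ 0 := ne_zero_of_zmod (by push_cast; exact k3)
  have l4 : b + 2 * c - 2 * a + d ≠ 0 := ne_zero_of_zmod (by push_cast; exact k4)
  have l5 : 2 * b + c - a + 2 * d ≠ 0 := ne_zero_of_zmod (by push_cast; exact k5)
  have l6 : 2 * b - a ≠ 0 := ne_zero_of_zmod (by push_cast; exact k6)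
  refine ⟨?_, l1, l2, l3, l4, l5, l6⟩
  unfold EN
  rw [sN_of_ne rfl rfl l1 l2, sN_of_ne (by ring) (by ring) l3 l4, sN_of_ne (by ring) (by ring) l5 l6]

lemma EN_zero {n a b c d : ℤ} (hn : (n : ZMod 3) ≠ 0) (h : a * d + b * c = n)
    (hd : (a + b + c - d : ZMod 3) = 0) :
    EN a b c d + EN b (b - a) (-d) (c + d) + EN (b - a) (-a) (-c - d) c = 0 := by
  have three : (3 : ZMod 3) = 0 := by decide
  obtain ⟨e0, p1, p2, p3, p4, p5, p6⟩ := EN_val hn h hd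
  obtain ⟨e1, q1, q2, q3, q4, q5, q6⟩ := EN_val (a := b) (b := b - a) (c := -d) (d := c + d) hn
    (by linarith) (by push_cast; linear_combination -hd + b * three - d * three)
  obtain ⟨e2, r1, r2, r3, r4, r5, r6⟩ := EN_val (a := b - a) (b := - a) (c := -c-d) (d := c) hn
    (by linarith) (by push_cast; linear_combination hd - a * three - c * three)
  have t0 := tri p1 p2 (by intro h0; apply r5; linear_combination h0)
  have t1 := tri q1 q2 (by intro h0; apply p5; linear_combination -h0)
  have t2 := tri r1 r2 (by intro h0; apply q5; linear_combination -h0)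
  rw [e0, e1, e2]
  have f1 : ((2 * c + d) * (b + 2 * c - 2 * a + d)).sign =
    ((-c - d - c) * ((-c - d - c) - (b - a + -a))).sign := by congr 1; ring
  have f2 : ((2 * b + c - a + 2 * d) * (2 * b - a)).sign =
    - ((b + (b - a)) * ((-d - (c + d)) - (b + (b - a)))).sign := by rw [← sg_neg']; congr 1; ring
  have g1 : ((2 * -d + (c + d)) * (b - a + 2 * -d - 2 * b + (c + d))).sign =
    ((c - d) * (c - d - (a + b))).sign := by congr 1; ring
  have g2 : ((2 * (b - a) + -d - b + 2 * (c + d)) * (2 * (b - a) - b)).sign =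
    - ((b - a + -a) * (-c - d - c - (b - a + -a))).sign := by rw [← sg_neg']; congr 1; ring
  have h1 : ((2 * (-c - d) + c) * (-a + 2 * (-c - d) - 2 * (b - a) + c)).sign =
    ((-d - (c + d)) * ((-d - (c + d)) - (b + (b - a)))).sign := by congr 1; ring
  have h2 : ((2 * -a + (-c - d) - (b - a) + 2 * c) * (2 * -a - (b - a))).sign =
    - ((a + b) * (c - d - (a + b))).sign := by rw [← sg_neg']; congr 1; ring
  rw [f1, f2, g1, g2, h1, h2]
  linarith

lemma if_zmod_congr {x y : ZMod 3} (h : x = y ∨ x = -y) :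
    (if x = 0 then (1 : ℤ) else 0) = if y = 0 then 1 else 0 := by
  rcases h with rfl | rfl
  · rfl
  · simp

/-- Second main identity. -/
theorem T0a {n : ℤ} (hn : 0 < n) (hn3 : (n : ZMod 3) ≠ 0) :
    Sm n (fun a b c d => (dI a b c d + dO a b c d + dP a b c d + dN a b c d) * root2 a b c d) =
      3 * Sm n (fun a b c d => dI a b c d * EI a b c d) := by
  have fr := FS_root2 hn
  have three : (3 : ZMod 3) = 0 := by decide
  have a1 : ∀ a b c d, dO (c + d) c (b + c - a + d) (a - c) = dI a b c d := fun _ _ _ _ => rfl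
  have a2 : ∀ a b c d, dP (b + d) (b + c - a + d) b (a - b) = dI a b c d := by
    intro a b c d; unfold dP dI; push_cast
    exact if_zmod_congr (Or.inr (by linear_combination 0 * three))
  have a3 : ∀ a b c d, dN (c + d) c (b + c - a + d) (a - c) = dN a b c d := by
    intro a b c d; unfold dN; push_cast
    exact if_zmod_congr (Or.inl (by linear_combination (c - a + d) * three))
  have a4 : ∀ a b c d, dN (b + d) (b + c - a + d) b (a - b) = dN a b c d := by
    intro a b c d; unfold dN; push_cast
    exact if_zmod_congr (Or.inl (by linear_combination (b - a + d) * three))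
  have a5 : ∀ a b c d, dN d c b a = dP a b c d := by
    intro a b c d; unfold dN dP; push_cast
    exact if_zmod_congr (Or.inr (by linear_combination 0 * three))
  have a6 : ∀ a b c d, dO d c b a = dI a b c d := fun _ _ _ _ => rfl
  have a7 : ∀ a b c d, dN b (b - a) (-d) (c + d) = dN a b c d := by
    intro a b c d; unfold dN; push_cast
    exact if_zmod_congr (Or.inr (by linear_combination (b - d) * three))
  have fI := FS.mul dI (f := HI) (FS_HI hn)
  have fO := FS.mul dO (f := HO) (FS_HO hn)
  have fP := FS.mul dP (f := HP) (FS_HP hn)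
  have fN := FS.mul dN (f := HN) (FS_HN hn)
  have fE := FS.mul dI (FS_EI hn)
  have fEN := FS.mul dN (FS_EN hn)
  have e0 : Sm n (fun a b c d => (dI a b c d + dO a b c d + dP a b c d + dN a b c d) * root2 a b c d)
      = Sm n (fun a b c d => dI a b c d * root2 a b c d)
      + Sm n (fun a b c d => dO a b c d * root2 a b c d)
      + Sm n (fun a b c d => dP a b c d * root2 a b c d)
      + Sm n (fun a b c d => dN a b c d * root2 a b c d) := by
    rw [← Sm_add (fr.mul dI) (fr.mul dO), ← Sm_add ((fr.mul dI).add (fr.mul dO)) (fr.mul dP),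
      ← Sm_add (((fr.mul dI).add (fr.mul dO)).add (fr.mul dP)) (fr.mul dN)]
    apply Sm_congr
    intro a b c d _
    ring
  have rU2 : ∀ a b c d, root2 (b + d) (b + c - a + d) b (a - b) = root2 a b c d := by
    intro a b c d
    rw [← root2_U]
    congr 1 <;> ring
  have e1 : Sm n (fun a b c d => dO a b c d * root2 a b c d) =
      Sm n (fun a b c d => dI a b c d * root2 a b c d) := by
    rw [← Sm_U n (fun a b c d => dO a b c d * root2 a b c d)]
    exact Sm_congr (fun a b c d _ => by rw [root2_U, a1])
  have e2 : Sm n (fun a b c d => dP a b c d * root2 a b c d) =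
      Sm n (fun a b c d => dI a b c d * root2 a b c d) := by
    rw [← Sm_U2 n (fun a b c d => dP a b c d * root2 a b c d)]
    exact Sm_congr (fun a b c d _ => by rw [rU2, a2])
  have e3 : Sm n (fun a b c d => dI a b c d * root2 a b c d) =
      Sm n (fun a b c d => dI a b c d * HI a b c d) + Sm n (fun a b c d => dO a b c d * HO a b c d)
      + Sm n (fun a b c d => dP a b c d * HP a b c d) + Sm n (fun a b c d => dI a b c d * EI a b c d) := by
    rw [← Sm_U n (fun a b c d => dO a b c d * HO a b c d),
      ← Sm_U2 n (fun a b c d => dP a b c d * HP a b c d),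
      ← Sm_add fI fO.U, ← Sm_add (fI.add fO.U) fP.U2, ← Sm_add ((fI.add fO.U).add fP.U2) fE]
    apply Sm_congr
    intro a b c d h
    rw [root2_decI, a1, a2]
    ring
  have e4 : Sm n (fun a b c d => dN a b c d * root2 a b c d) =
      Sm n (fun a b c d => dN a b c d * HN a b c d) + Sm n (fun a b c d => dN a b c d * HN a b c d)
      + Sm n (fun a b c d => dN a b c d * HN a b c d) + Sm n (fun a b c d => dN a b c d * EN a b c d) := by
    nth_rewrite 3 [← Sm_U2 n (fun a b c d => dN a b c d * HN a b c d)]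
    nth_rewrite 2 [← Sm_U n (fun a b c d => dN a b c d * HN a b c d)]
    rw [← Sm_add fN fN.U, ← Sm_add (fN.add fN.U) fN.U2, ← Sm_add ((fN.add fN.U).add fN.U2) fEN]
    apply Sm_congr
    intro a b c d h
    rw [root2_decN, a3, a4]
    ring
  have e5 : Sm n (fun a b c d => dO a b c d * HO a b c d) =
      - Sm n (fun a b c d => dI a b c d * HI a b c d) := by
    rw [← Sm_neg, ← Sm_S]
    apply Sm_congr
    intro a b c d h
    rw [a6, HO_eq]; ring
  have e6 : Sm n (fun a b c d => dN a b c d * HN a b c d) =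
      - Sm n (fun a b c d => dP a b c d * HP a b c d) := by
    rw [← Sm_neg, ← Sm_S]
    apply Sm_congr
    intro a b c d h
    rw [a5, HN_eq]; ring
  have e7 : Sm n (fun a b c d => dN a b c d * EN a b c d) = 0 := by
    have h1 := Sm_RU n (fun a b c d => dN a b c d * EN a b c d)
    have h2 := Sm_RU n (fun a b c d => dN b (b - a) (-d) (c + d) * EN b (b - a) (-d) (c + d))
    have h3 : Sm n (fun a b c d => (dN a b c d * EN a b c d + dN b (b - a) (-d) (c + d) * EN b (b - a) (-d) (c + d)) +
      dN (b - a) (b - a - b) (-(c + d)) (-d + (c + d)) *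
        EN (b - a) (b - a - b) (-(c + d)) (-d + (c + d))) = Sm n (fun _ _ _ _ => 0) := by
      apply Sm_congr
      intro a b c d h
      rw [a7, a7 b, a7, show b - a - b = -a by ring, show -(c+d) = -c - d by ring,
        show -d + (c + d) = c by ring]
      by_cases hd : (a + b + c - d : ZMod 3) = 0
      · have := EN_zero hn3 h hd
        rw [← mul_add, ← mul_add, this, mul_zero]
      · simp [dN, hd]
    have h4 : Sm n (fun _ _ _ _ => 0) = 0 := by
      unfold Sm; simp [ext4]
    have q := Sm_add (fEN.add fEN.RU) fEN.RU.RU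
    rw [h3, h4, Sm_add fEN fEN.RU, h2, h1] at q
    linarith
  linarith


/-! ### one-dimensional sums -/

lemma fin_sgn (m : ℤ) : (Function.support (fun d : ℤ => (d + m).sign - d.sign)).Finite := by
  refine (Set.finite_Icc (-|m|) |m|).subset ?_
  intro d hd
  have := sgn_diff (x := d + m) (y := d) hd
  rw [add_sub_cancel_left] at this
  simpa [abs_le] using this

lemma sum_sgn1 : ∑ᶠ d : ℤ, ((d + 1).sign - d.sign) = 2 := by
  rw [finsum_eq_sum_of_support_subset (s := {-1, 0})]
  · simp
  · intro d hd
    simp only [Function.mem_support] at hd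
    simp only [Finset.coe_insert, Finset.coe_singleton, Set.mem_insert_iff, Set.mem_singleton_iff]
    by_contra h
    apply hd
    rcases lt_or_ge d 0 with h1 | h1
    · rw [Int.sign_eq_neg_one_of_neg h1, Int.sign_eq_neg_one_of_neg (by omega)]; rfl
    · rw [Int.sign_eq_one_of_pos (by omega), Int.sign_eq_one_of_pos (by omega)]; rfl

lemma sum_sgn_succ (m : ℤ) : ∑ᶠ d : ℤ, ((d + (m + 1)).sign - d.sign) =
    ∑ᶠ d : ℤ, ((d + m).sign - d.sign) + 2 := by
  have h := finsum_comp_equiv (Equiv.addRight (1 : ℤ)) (f := fun d : ℤ => (d + m).sign - d.sign)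
  rw [← sum_sgn1, ← h, ← finsum_add_distrib]
  · apply finsum_congr
    intro d
    simp only [Equiv.coe_addRight]
    rw [show d + 1 + m = d + (m + 1) by ring]; ring
  · exact (fin_sgn m).preimage ((Equiv.addRight (1 : ℤ)).injective.injOn)
  · exact fin_sgn 1

lemma sum_sgn (m : ℤ) : ∑ᶠ d : ℤ, ((d + m).sign - d.sign) = 2 * m := by
  induction m using Int.induction_on with
  | zero => simp
  | succ i ih => rw [sum_sgn_succ, ih]; ring
  | pred i ih =>
    have := sum_sgn_succ (-(i : ℤ) - 1)
    rw [sub_add_cancel, ih] at this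
    linarith

lemma fin_sgn2 (m : ℤ) : (Function.support (fun d : ℤ => (m + 2 * d).sign - d.sign)).Finite := by
  refine (Set.finite_Icc (-|m|) |m|).subset ?_
  intro d hd
  simp only [Function.mem_support] at hd
  rcases abs_cases m with ⟨h5, h6⟩ | ⟨h5, h6⟩ <;> rw [h5] <;>
  rcases sgn3 (m + 2 * d) with ⟨h1, h1'⟩ | ⟨h1, h1'⟩ | ⟨h1, h1'⟩ <;>
  rcases sgn3 d with ⟨h2, h2'⟩ | ⟨h2, h2'⟩ | ⟨h2, h2'⟩ <;>
  rw [h1', h2'] at hd <;> simp at hd <;> constructor <;> omega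

lemma sum_sgn2 (m : ℤ) : ∑ᶠ d : ℤ, ((m + 2 * d).sign - d.sign) = m := by
  have h := finsum_comp_equiv ((Equiv.neg ℤ).trans (Equiv.addRight (-m)))
    (f := fun d : ℤ => (m + 2 * d).sign - d.sign)
  have h2 := sum_sgn m
  have h3 : ∑ᶠ d : ℤ, ((d + m).sign - d.sign) = ∑ᶠ d : ℤ, ((m + 2 * d).sign - d.sign) +
      ∑ᶠ d : ℤ, ((m + 2 * d).sign - d.sign) := by
    nth_rewrite 2 [← h]
    rw [← finsum_add_distrib (fin_sgn2 m)]
    · apply finsum_congr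
      intro d
      simp only [Equiv.trans_apply, Equiv.neg_apply, Equiv.coe_addRight]
      rw [show m + 2 * (-d + -m) = -(m + 2 * d) by ring, show -d + -m = -(d + m) by ring,
        sg_neg', sg_neg']
      ring
    · exact (fin_sgn2 m).preimage (Equiv.injective _).injOn
  linarith

/-! ### fibring -/
def eF : ((ℤ × ℤ) × (ℤ × ℤ)) ≃ (ℤ × ℤ × ℤ × ℤ) where
  toFun v := (v.2.1, v.1.1, v.1.2, v.2.2)
  invFun v := ((v.2.1, v.2.2.1), (v.1, v.2.2.2))
  left_inv _ := rfl
  right_inv _ := rfl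

lemma Sm_fib {n : ℤ} (hn : n ≠ 0) (g : ℤ → ℤ → ℤ → ℤ)
    (hf : FS n (fun a b c d => if a = 0 then g b c d else 0)) :
    Sm n (fun a b c d => if a = 0 then g b c d else 0) =
      ∑ p ∈ Int.divisorsAntidiag n, ∑ᶠ d, g p.1 p.2 d := by
  unfold Sm
  have hs := hf.supp
  set F := ext4 n (fun a b c d => if a = 0 then g b c d else 0) with hF
  rw [← finsum_comp_equiv eF]
  have hs2 : (Function.support (fun v => F (eF v))).Finite := hs.preimage eF.injective.injOn
  rw [finsum_curry _ hs2]
  have key : ∀ p : ℤ × ℤ, ∑ᶠ q : ℤ × ℤ, F (eF (p, q)) =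
      if p.1 * p.2 = n then ∑ᶠ d, g p.1 p.2 d else 0 := by
    intro p
    have hs3 : (Function.support (fun q => F (eF (p, q)))).Finite :=
      hs2.preimage (f := fun q => (p, q)) (Prod.mk_right_injective p).injOn
    rw [finsum_curry _ hs3, finsum_eq_single _ 0]
    · simp only [hF, ext4, eF, Equiv.coe_fn_mk, zero_mul, zero_add, if_true]
      split_ifs
      · rfl
      · simp
    · intro a ha
      simp only [hF, ext4, eF, Equiv.coe_fn_mk, if_neg ha, ite_self, finsum_zero]
  rw [finsum_congr key, finsum_eq_sum_of_support_subset (s := Int.divisorsAntidiag n)]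
  · apply Finset.sum_congr rfl
    intro p hp
    rw [if_pos (Int.mem_divisorsAntidiag.mp hp).1]
  · intro p hp
    simp only [Function.mem_support] at hp
    simp only [Finset.mem_coe, Int.mem_divisorsAntidiag]
    refine ⟨?_, hn⟩
    by_contra h
    exact hp (if_neg h)

lemma sum_antidiag (n : ℕ) (h : ℤ → ℤ → ℤ) :
    ∑ p ∈ Int.divisorsAntidiag n, h p.1 p.2 =
      ∑ d ∈ n.divisors, (h d (n / d : ℕ) + h (-d) (-(n / d : ℕ))) := by
  rw [Int.divisorsAntidiag_natCast, Finset.sum_disjUnion, Finset.sum_map, Finset.sum_map,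
    ← Finset.sum_add_distrib, ← Nat.sum_divisorsAntidiagonal (fun a b => h a b + h (-a) (-b))]
  rfl

def sgm (n : ℕ) : ℤ := ∑ d ∈ n.divisors, (d : ℤ)

lemma sgm' (n : ℕ) : ∑ d ∈ n.divisors, ((n / d : ℕ) : ℤ) = sgm n :=
  Nat.sum_div_divisors n (fun d => (d : ℤ))

/-! ### sums of EI -/
def eV : (ℤ × ℤ × ℤ × ℤ) ≃ (ℤ × ℤ × ℤ × ℤ) where
  toFun v := (v.2.2.2, v.2.1 - v.1 + v.2.2.2, v.2.2.1, v.1)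
  invFun v := (v.2.2.2, v.2.1 - v.1 + v.2.2.2, v.2.2.1, v.1)
  left_inv v := by ext <;> simp
  right_inv v := by ext <;> simp

def eW : (ℤ × ℤ × ℤ × ℤ) ≃ (ℤ × ℤ × ℤ × ℤ) where
  toFun v := (v.2.2.1 - v.1, v.2.1 + v.2.2.2 - v.1 + v.2.2.1, v.2.2.1, - v.2.2.1 - v.2.2.2)
  invFun v := (v.2.2.1 - v.1, v.2.1 + v.2.2.2 - v.1 + v.2.2.1, v.2.2.1, - v.2.2.1 - v.2.2.2)
  left_inv v := by ext <;> simp <;> ring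
  right_inv v := by ext <;> simp <;> ring

lemma Sm_V (n : ℤ) (f : ℤ → ℤ → ℤ → ℤ) :
    Sm n (fun a b c d => if c = 0 then f d (b - a + d) a else 0) =
    Sm n (fun a b c d => if c = 0 then f a b d else 0) := by
  apply Sm_equiv eV
  rintro ⟨a, b, c, d⟩
  simp only [ext4, eV, Equiv.coe_fn_mk]
  by_cases hc : c = 0
  · subst hc
    simp [mul_comm]
  · simp [hc]

lemma Sm_W (n f) : Sm n (fun a b c d => f (c - a) (b + d - a + c) c (-c - d)) = Sm n f :=
  Sm_equiv eW (by
    rintro ⟨a, b, c, d⟩; simp only [ext4, eW, Equiv.coe_fn_mk]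
    exact if_congr (by constructor <;> intro h <;> linarith) rfl rfl)

lemma FS.ite {n f} (p : ℤ → ℤ → ℤ → ℤ → Prop) [∀ a b c d, Decidable (p a b c d)] (hf : FS n f) :
    FS n (fun a b c d => if p a b c d then f a b c d else 0) :=
  (hf.mul (fun a b c d => if p a b c d then 1 else 0)).congr (fun a b c d _ => by
    split_ifs <;> simp)

lemma Ec {n : ℤ} (hn : 0 < n) (φ : ℤ → ℤ → ℤ → ℤ → ℤ)
    (h : ∀ a b d, a * d = n → φ d (b - a + d) 0 a = φ a b 0 d) :
    Sm n (fun a b c d => if c = 0 then φ a b c d * EI a b c d else 0) = 0 := by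
  have e1 : Sm n (fun a b c d => if c = 0 then φ a b c d * EI a b c d else 0) =
      Sm n (fun a b c d => if c = 0 then φ a b 0 d * EI a b 0 d else 0) :=
    Sm_congr (fun a b c d _ => by split_ifs with hc <;> [rw [hc]; rfl])
  have e2 := Sm_V n (fun a b d => φ a b 0 d * EI a b 0 d)
  have e3 : Sm n (fun a b c d => if c = 0 then φ d (b - a + d) 0 a * EI d (b - a + d) 0 a else 0) =
      - Sm n (fun a b c d => if c = 0 then φ a b 0 d * EI a b 0 d else 0) := by
    rw [← Sm_neg]
    apply Sm_congr
    intro a b c d h1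
    split_ifs with hc
    · subst hc
      have had : a * d = n := by linarith
      have ha : a ≠ 0 := by rintro rfl; simp at had; omega
      have hd : d ≠ 0 := by rintro rfl; simp at had; omega
      rw [h a b d had, EI_c ha, EI_c hd]
      have hs : a.sign = d.sign := by
        rcases pos_and_pos_or_neg_and_neg_of_mul_pos (had ▸ hn) with ⟨h1, h2⟩ | ⟨h1, h2⟩
        · rw [Int.sign_eq_one_of_pos h1, Int.sign_eq_one_of_pos h2]
        · rw [Int.sign_eq_neg_one_of_neg h1, Int.sign_eq_neg_one_of_neg h2]
      rw [show b - a + d - d + a = b by ring]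
      simp only [Int.sign_mul, hs]
      ring
    · simp
  rw [e1]
  linarith

lemma Eall {n : ℤ} (hn : 0 < n) (φ : ℤ → ℤ → ℤ → ℤ → ℤ)
    (h : ∀ a b d, a * d = n → φ d (b - a + d) 0 a = φ a b 0 d)
    (h' : ∀ b c d, b * c = n → φ c (b + d + c) c (-c - d) = φ 0 b c d) :
    Sm n (fun a b c d => φ a b c d * EI a b c d) =
      2 * ∑ p ∈ Int.divisorsAntidiag n, ∑ᶠ d, φ 0 p.1 p.2 d * (p.1.sign *
        ((2 * p.1 + p.2 + 2 * d).sign - d.sign)) := by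
  have fE := (FS_EI hn).mul φ
  have f1 := fE.ite (fun _ _ c _ => c = 0)
  have f2 := fE.ite (fun a _ _ _ => a = 0)
  have f3 := fE.ite (fun a _ c _ => a = c)
  have e1 : Sm n (fun a b c d => φ a b c d * EI a b c d) =
      Sm n (fun a b c d => if c = 0 then φ a b c d * EI a b c d else 0)
      + Sm n (fun a b c d => if a = 0 then φ a b c d * EI a b c d else 0)
      + Sm n (fun a b c d => if a = c then φ a b c d * EI a b c d else 0) := by
    rw [← Sm_add f1 f2, ← Sm_add (f1.add f2) f3]
    apply Sm_congr
    intro a b c d hs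
    by_cases hc : c = 0
    · subst hc
      have : a ≠ 0 := by rintro rfl; simp at hs; omega
      simp [this]
    · by_cases ha : a = 0
      · subst ha
        simp [hc, Ne.symm hc]
      · by_cases hac : a = c
        · simp [ha, hc, hac]
        · simp [ha, hc, hac, EI_gen ha hc hac]
  have e2 : Sm n (fun a b c d => if a = c then φ a b c d * EI a b c d else 0) =
      Sm n (fun a b c d => if a = 0 then φ a b c d * EI a b c d else 0) := by
    rw [← Sm_W]
    apply Sm_congr
    intro a b c d hs
    by_cases ha : a = 0
    · subst ha
      have hbc : b * c = n := by linarith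
      have hc : c ≠ 0 := by rintro rfl; simp at hbc; omega
      simp only [sub_zero, if_true]
      rw [h' b c d hbc, EI_ac hc, EI_a hc,
        show (b + d + c + (-c - d)) * (c + (-c - d)) = - (b * d) by ring,
        show (b + d + c + (-c - d)) * (2 * (b + d + c) - c) = b * (2 * b + c + 2 * d) by ring,
        sg_neg']
      ring
    · simp [ha]
  have e3 : Sm n (fun a b c d => if a = 0 then φ a b c d * EI a b c d else 0) =
      Sm n (fun a b c d => if a = 0 then φ 0 b c d * (b.sign *
        ((2 * b + c + 2 * d).sign - d.sign)) else 0) := by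
    apply Sm_congr
    intro a b c d hs
    split_ifs with ha
    · subst ha
      have hbc : b * c = n := by linarith
      have hc : c ≠ 0 := by rintro rfl; simp at hbc; omega
      rw [EI_a hc, Int.sign_mul, Int.sign_mul]; ring
    · rfl
  rw [e1, e2, Ec hn φ h, e3, Sm_fib hn.ne']
  · ring
  · apply f2.congr
    intro a b c d hs
    split_ifs with ha
    · subst ha
      have hbc : b * c = n := by linarith
      have hc : c ≠ 0 := by rintro rfl; simp at hbc; omega
      rw [EI_a hc, Int.sign_mul, Int.sign_mul]; ring
    · rfl

lemma T0 {n : ℤ} (hn : 0 < n) (hn3 : (n : ZMod 3) ≠ 0) :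
    Sm n (fun a b c d => (dI a b c d + dO a b c d + dP a b c d + dN a b c d) * root2 a b c d) = 0 := by
  rw [T0a hn hn3]
  have := Ec hn dI (fun a b d _ => rfl)
  rw [mul_eq_zero]; right
  rw [← this]
  apply Sm_congr
  intro a b c d h
  by_cases hc : c = 0
  · simp [hc]
  · rw [if_neg hc]
    by_cases h3 : (c : ZMod 3) = 0
    · have ha : a ≠ 0 := by
        rintro rfl
        apply hn3; rw [← h]; push_cast; rw [h3]; ring
      have hac : a ≠ c := by
        rintro rfl
        apply hn3; rw [← h]; push_cast; rw [h3]; ring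
      rw [EI_gen ha hc hac, mul_zero]
    · simp [dI, h3]

lemma sigma_sum (n : ℕ) (hn : 0 < n) :
    ∑ p ∈ Int.divisorsAntidiag n, p.1.sign * (2 * p.1 + p.2) = 6 * sgm n := by
  rw [sum_antidiag n (fun a b => a.sign * (2 * a + b))]
  have : ∀ d ∈ n.divisors, ((d : ℤ).sign * (2 * (d:ℤ) + (n / d : ℕ)) +
      (-(d : ℤ)).sign * (2 * (-(d:ℤ)) + (-(n / d : ℕ)))) = 4 * (d : ℤ) + 2 * ((n / d : ℕ) : ℤ) := by
    intro d hd
    have hd : 0 < (d : ℤ) := by exact_mod_cast Nat.pos_of_mem_divisors hd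
    rw [sg_neg', Int.sign_eq_one_of_pos hd]; ring
  rw [Finset.sum_congr rfl this, Finset.sum_add_distrib, ← Finset.mul_sum, ← Finset.mul_sum, sgm']
  unfold sgm; ring


def tau (t : ℤ) : ℤ := if (t : ZMod 3) = 0 then 0 else 1

def fixz (a b c d : ZMod 3) : ℤ :=
  (if c = 0 then 1 else 0) + (if b = 0 then 1 else 0) + (if a - b - c - d = 0 then 1 else 0) +
    (if a + b + c - d = 0 then 1 else 0)
def phiz (a b c d : ZMod 3) : ℤ := 4 * (if a + d = 0 then 0 else 1) - fixz a b c d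

lemma fixz_eq (a b c d : ℤ) :
    dI a b c d + dO a b c d + dP a b c d + dN a b c d = fixz a b c d := rfl

theorem main2 (n : ℕ) (hn : 0 < n) (h : n % 3 = 2) :
    Sm n (fun a b c d => tau (a + d) * root2 a b c d) = 12 * sgm n := by
  have hn' : (0 : ℤ) < n := by exact_mod_cast hn
  have hz : ((n : ℤ) : ZMod 3) = 2 := by
    have := (ZMod.natCast_eq_natCast_iff' n 2 3).mpr (by omega)
    exact_mod_cast this
  have fr := FS_root2 hn'
  have t0 := T0 hn' (by rw [hz]; decide)
  have t1 := T1 hn' (fun _ _ _ _ => 1) (fun _ _ _ _ _ => rfl) (fun _ _ _ _ _ => rfl)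
    (fun _ _ _ _ _ => rfl)
  rw [Eall hn' (fun _ _ _ _ => 1) (fun _ _ _ _ => rfl) (fun _ _ _ _ => rfl)] at t1
  have e1 : ∀ p : ℤ × ℤ, ∑ᶠ d : ℤ, 1 * (p.1.sign * ((2 * p.1 + p.2 + 2 * d).sign - d.sign)) =
      p.1.sign * (2 * p.1 + p.2) := by
    intro p
    simp only [one_mul]
    rw [← mul_finsum, sum_sgn2]
  rw [Finset.sum_congr rfl (fun p _ => e1 p), sigma_sum n hn] at t1
  have key : ∀ a b c d : ZMod 3, a * d + b * c = 2 →
      fixz a b c d = 2 * (1 - if a + d = 0 then 0 else 1) := by decide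
  have e2 : Sm n (fun a b c d => (dI a b c d + dO a b c d + dP a b c d + dN a b c d) * root2 a b c d)
    = Sm n (fun a b c d => 2 * (1 * root2 a b c d) - 2 * (tau (a + d) * root2 a b c d)) := by
    apply Sm_congr
    intro a b c d hs
    rw [fixz_eq, key a b c d (by rw [← hz, ← hs]; push_cast; rfl)]
    unfold tau
    push_cast
    ring
  have fr1 := fr.mul (fun _ _ _ _ => 1)
  have fr2 := fr.mul (fun a _ _ d => tau (a + d))
  rw [Sm_sub (fr1.mul (fun _ _ _ _ => 2)) (fr2.mul (fun _ _ _ _ => 2)), Sm_mul 2 fr1, Sm_mul 2 fr2,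
    t0] at e2
  linarith

theorem main1 (n : ℕ) (hn : 0 < n) (h : n % 3 = 1) :
    Sm n (fun a b c d => tau (a + d) * root2 a b c d) = 6 * sgm n := by
  have hn' : (0 : ℤ) < n := by exact_mod_cast hn
  have hz : ((n : ℤ) : ZMod 3) = 1 := by
    have := (ZMod.natCast_eq_natCast_iff' n 1 3).mpr (by omega)
    exact_mod_cast this
  have fr := FS_root2 hn'
  have t0 := T0 hn' (by rw [hz]; decide)
  have hc : ∀ a b c d : ℤ, a * d + b * c = n → (a * d + b * c : ZMod 3) = 1 := by
    intro a b c d hs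
    rw [← hz, ← hs]; push_cast; rfl
  have k1 : ∀ a b c d : ZMod 3, a * d + b * c = 1 → phiz d c b a = phiz a b c d := by decide
  have k2 : ∀ a b c d : ZMod 3, a * d + b * c = 1 →
    phiz (c + d) c (b + c - a + d) (a - c) = phiz a b c d := by decide
  have k3 : ∀ a b c d : ZMod 3, a * d + b * c = 1 → phiz (-b) a d (-c) = phiz a b c d := by decide
  have k4 : ∀ a b d : ZMod 3, a * d = 1 → phiz d (b - a + d) 0 a = phiz a b 0 d := by decide
  have k5 : ∀ b c d : ZMod 3, b * c = 1 → phiz c (b + d + c) c (-c - d) = phiz 0 b c d := by decide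
  have k6 : ∀ b c d : ZMod 3, b * c = 1 → phiz 0 b c d = 3 - 3 * if d = 0 then 1 else 0 := by decide
  have k7 : ∀ b c : ZMod 3, b * c = 1 → 2 * b + c = 0 := by decide
  have t1 := T1 hn' (fun a b c d => phiz a b c d)
    (fun a b c d hs => k1 _ _ _ _ (hc _ _ _ _ hs))
    (fun a b c d hs => by push_cast; exact k2 _ _ _ _ (hc _ _ _ _ hs))
    (fun a b c d hs => by push_cast; exact k3 _ _ _ _ (hc _ _ _ _ hs))
  have hc2 : ∀ a b : ℤ, a * b = n → (a * b : ZMod 3) = 1 := by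
    intro a b hs
    rw [← hz, ← hs]; push_cast; rfl
  rw [Eall hn' (fun a b c d => phiz a b c d)
    (fun a b d hs => by push_cast; exact k4 _ _ _ (hc2 _ _ hs))
    (fun b c d hs => by push_cast; exact k5 _ _ _ (hc2 _ _ hs))] at t1
  have e1 : ∀ p ∈ Int.divisorsAntidiag n, ∑ᶠ d : ℤ, phiz ((0 : ℤ) : ZMod 3) p.1 p.2 d *
      (p.1.sign * ((2 * p.1 + p.2 + 2 * d).sign - d.sign)) =
      2 * (p.1.sign * (2 * p.1 + p.2)) := by
    rintro ⟨b, c⟩ hp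
    have hbc := (Int.mem_divisorsAntidiag.mp hp).1
    simp only at hbc
    have hm : ((2 * b + c : ℤ) : ZMod 3) = 0 := by
      push_cast; exact k7 b c (hc2 b c hbc)
    obtain ⟨m, hm⟩ := (ZMod.intCast_zmod_eq_zero_iff_dvd _ 3).mp hm
    push_cast at hm
    set F : ℤ → ℤ := fun d => (2 * b + c + 2 * d).sign - d.sign with hF
    have s1 : ∑ᶠ d, F d = 2 * b + c := sum_sgn2 _
    have fF : (Function.support F).Finite := fin_sgn2 _
    have s2 : ∑ᶠ d : ℤ, (if ((d : ℤ) : ZMod 3) = 0 then F d else 0) = m := by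
      rw [← sum_sgn2 m]
      have h1 : ∀ j : ℤ, (m + 2 * j).sign - j.sign = F (3 * j) := by
        intro j
        simp only [hF]
        rw [hm, show 3 * m + 2 * (3 * j) = 3 * (m + 2 * j) by ring, Int.sign_mul, Int.sign_mul,
          Int.sign_eq_one_of_pos (show (0 : ℤ) < 3 by norm_num), one_mul, one_mul]
      classical
      rw [finsum_congr h1, ← finsum_mem_range (f := F) (g := fun j : ℤ => 3 * j)
        (fun x y hxy => by simpa using hxy)]
      apply finsum_congr
      intro d
      rw [finsum_eq_if]
      apply if_congr _ rfl rfl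
      rw [ZMod.intCast_zmod_eq_zero_iff_dvd]
      simp only [Set.mem_range]
      constructor
      · rintro ⟨k, hk⟩; exact ⟨k, by rw [hk]; rfl⟩
      · rintro ⟨k, hk⟩; exact ⟨k, by rw [← hk]; rfl⟩
    have s3 : ∑ᶠ d : ℤ, phiz ((0 : ℤ) : ZMod 3) b c d * (b.sign * F d) =
        ∑ᶠ d : ℤ, (b.sign * (3 * F d) - b.sign * (3 * (if ((d : ℤ) : ZMod 3) = 0 then F d else 0))) := by
      apply finsum_congr
      intro d
      rw [Int.cast_zero, k6 b c d (hc2 b c hbc)]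
      split_ifs <;> ring
    change ∑ᶠ d : ℤ, phiz ((0 : ℤ) : ZMod 3) b c d * (b.sign * F d) = _
    have fF2 : (Function.support (fun d : ℤ => if ((d : ℤ) : ZMod 3) = 0 then F d else 0)).Finite := by
      refine fF.subset ?_
      intro d hd
      simp only [Function.mem_support] at hd ⊢
      intro h; simp [h] at hd
    rw [s3, finsum_sub_distrib, ← mul_finsum, ← mul_finsum, ← mul_finsum, ← mul_finsum, s1, s2]
    · linear_combination b.sign * hm
    · refine fF.subset ?_
      intro d hd
      simp only [Function.mem_support] at hd ⊢
      intro h; simp [h] at hd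
    · refine fF2.subset ?_
      intro d hd
      simp only [Function.mem_support] at hd ⊢
      intro h; simp [h] at hd
  rw [Finset.sum_congr rfl e1, ← Finset.mul_sum, sigma_sum n hn] at t1
  have e2 : Sm n (fun a b c d => (phiz a b c d) * root2 a b c d)
    = Sm n (fun a b c d => 4 * (tau (a + d) * root2 a b c d) -
       (dI a b c d + dO a b c d + dP a b c d + dN a b c d) * root2 a b c d) := by
    apply Sm_congr
    intro a b c d hs
    rw [fixz_eq]
    unfold tau phiz
    push_cast
    ring
  have fr1 := fr.mul (fun a b c d => dI a b c d + dO a b c d + dP a b c d + dN a b c d)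
  have fr2 := fr.mul (fun a _ _ d => tau (a + d))
  rw [Sm_sub (fr2.mul (fun _ _ _ _ => 4)) fr1, Sm_mul 4 fr2, t0] at e2
  linarith


/-! ### evaluation of root2 -/

def w2 (A B C : ℤ) : ℤ := (2 * A + B).sign + (2 * C + B).sign + (-B).sign - 1

def wF (N : ℤ) (Q : ℤ × ℤ × ℤ) : ℤ :=
  if formDisc Q = -N ∧ 0 < Q.1 then w2 Q.1 Q.2.1 Q.2.2 else 0

lemma root2_neg (a b c d : ℤ) : root2 (-a) (-b) (-c) (-d) = root2 a b c d := by
  unfold root2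
  rw [rho_neg, ← rho_neg (c + d), ← rho_neg (b + d)]
  congr 1
  congr 1
  · congr 1; congr 1 <;> ring
  · congr 1 <;> ring

lemma root2_U2 (a b c d : ℤ) : root2 (b + d) (b + c - a + d) b (a - b) = root2 a b c d := by
  rw [← root2_U]
  congr 1 <;> ring

lemma root2_pos {a b c d : ℤ} (hb : 0 < b) (hc : 0 < c) (hz : 0 < b + c - a + d) :
    root2 a b c d = w2 c (d - a) b := by
  unfold root2 rho w2
  rw [if_pos (mul_pos hb hc), if_pos (mul_pos hc hz), if_pos (mul_pos hz hb)]
  simp only [Int.sign_mul, Int.sign_eq_one_of_pos hb, Int.sign_eq_one_of_pos hc,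
    Int.sign_eq_one_of_pos hz, mul_one]
  rw [show c + d - (a - c) = 2 * c + (d - a) by ring,
    show b + d - (a - b) = 2 * b + (d - a) by ring, show -(d - a) = a - d by ring]
  ring

lemma root2_mixed {a b c d : ℤ} (hb : 0 < b) (hc : 0 < c) (hz : b + c - a + d < 0) :
    root2 a b c d = 0 := by
  unfold root2 rho
  rw [if_pos (mul_pos hb hc), if_neg (not_lt.mpr (mul_neg_of_pos_of_neg hc hz).le),
    if_neg (not_lt.mpr (mul_neg_of_neg_of_pos hz hb).le)]
  simp only [Int.sign_mul, Int.sign_eq_one_of_pos hc]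
  rw [Int.sign_eq_one_of_pos (show 0 < a - d by linarith),
    Int.sign_eq_neg_one_of_neg (show b + c - a + d - c < 0 by linarith),
    Int.sign_eq_one_of_pos (show 0 < b - (b + c - a + d) by linarith),
    show c + d + (a - c) = b + d + (a - b) by ring]
  ring

lemma w2_hyp {A B C : ℤ} (hA : 0 < A) (hC : 0 < C) (hz : 0 < A + B + C) (h : 0 ≤ B ^ 2 - 4 * A * C) :
    w2 A B C = 0 := by
  have key : (2 * A + B) * (2 * C + B) + (2 * C + B) * (-B) + (-B) * (2 * A + B) ≤ 0 := by
    linarith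
  unfold w2
  rcases sgn3 (2 * A + B) with ⟨h1, h1'⟩ | ⟨h1, h1'⟩ | ⟨h1, h1'⟩ <;>
  rcases sgn3 (2 * C + B) with ⟨h2, h2'⟩ | ⟨h2, h2'⟩ | ⟨h2, h2'⟩ <;>
  rcases sgn3 (-B) with ⟨h3, h3'⟩ | ⟨h3, h3'⟩ | ⟨h3, h3'⟩ <;>
  rw [h1', h2', h3'] <;>
  first
  | rfl
  | (exfalso; omega)
  | (exfalso; have := mul_pos h1 h2; have := mul_pos h2 h3; have := mul_pos h1 h3; linarith)
  | (exfalso; have := mul_pos h1 h2; simp only [h3] at *; linarith)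
  | (exfalso; have := mul_pos h1 h3; simp only [h2] at *; linarith)
  | (exfalso; have := mul_pos h2 h3; simp only [h1] at *; linarith)

lemma root2_hyp_aux {a b c d : ℤ} (hc : 0 < c) (hb0 : b ≠ 0) (hz0 : b + c - a + d ≠ 0)
    (hD : 0 ≤ (a - d) ^ 2 - 4 * b * c) : root2 a b c d = 0 := by
  rcases lt_or_gt_of_ne hb0 with hb | hb <;> rcases lt_or_gt_of_ne hz0 with hz | hz
  · rw [← root2_neg, ← root2_U]
    apply root2_neg _ _ _ _ |>.symm.trans
    rw [root2_neg, ← root2_U]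
    apply root2_mixed <;> linarith
  · rw [← root2_U]
    apply root2_mixed <;> linarith
  · exact root2_mixed hb hc hz
  · rw [root2_pos hb hc hz]
    apply w2_hyp hc hb <;> linarith

lemma root2_hyp {a b c d : ℤ} (hb : b ≠ 0) (hc : c ≠ 0) (hz : b + c - a + d ≠ 0)
    (hD : 0 ≤ (a - d) ^ 2 - 4 * b * c) : root2 a b c d = 0 := by
  rcases lt_or_gt_of_ne hc with h | h
  · rw [← root2_neg]
    apply root2_hyp_aux
    · linarith
    · simpa using hb
    · intro h; apply hz; linarith
    · linarith
  · exact root2_hyp_aux h hb hz hD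

lemma ell_pos {A B C : ℤ} (hA : 0 < A) (h : B ^ 2 - 4 * A * C < 0) : 0 < C ∧ 0 < A + B + C := by
  have hC : 0 < C := by
    by_contra hC
    have : A * C ≤ 0 := mul_nonpos_of_nonneg_of_nonpos hA.le (not_lt.mp hC)
    nlinarith [sq_nonneg B]
  refine ⟨hC, ?_⟩
  by_contra hz
  have h1 : A + C ≤ -B := by linarith
  have h2 : (A + C) ^ 2 ≤ (-B) ^ 2 := pow_le_pow_left₀ (by linarith) h1 2
  nlinarith [sq_nonneg (A - C)]

lemma root2_ell {n a b c d : ℤ} (h : a * d + b * c = n) (ht : (a + d) ^ 2 < 4 * n) :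
    root2 a b c d = wF (4 * n - (a + d) ^ 2) (c, d - a, b) + wF (4 * n - (a + d) ^ 2) (-c, a - d, -b) := by
  have hD : (d - a) ^ 2 - 4 * c * b < 0 := by nlinarith
  have d1 : formDisc (c, d - a, b) = -(4 * n - (a + d) ^ 2) := by
    simp only [formDisc]; rw [← h]; ring
  have d2 : formDisc (-c, a - d, -b) = -(4 * n - (a + d) ^ 2) := by
    simp only [formDisc]; rw [← h]; ring
  have hc : c ≠ 0 := by rintro rfl; nlinarith [sq_nonneg (d - a)]
  unfold wF
  simp only [d1, d2, true_and]
  rcases lt_or_gt_of_ne hc with h1 | h1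
  · rw [if_neg (by linarith), if_pos (by linarith), ← root2_neg]
    obtain ⟨h2, h3⟩ := ell_pos (A := -c) (B := a - d) (C := -b) (by linarith) (by linarith)
    rw [root2_pos h2 (by linarith) (by linarith)]
    rw [zero_add]; congr 1; ring
  · rw [if_pos (by linarith), if_neg (by linarith)]
    obtain ⟨h2, h3⟩ := ell_pos h1 hD
    rw [root2_pos h2 h1 (by linarith), add_zero]

/-! cusps -/
lemma root2_c {n a b d : ℤ} (hn : 0 < n) (h : a * d = n) : root2 a b 0 d =
    if 0 < b * (b - a + d) then 0 else
      a.sign * ((b - a + d).sign - b.sign + (a - d).sign) - 1 := by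
  have key : (a + d).sign = a.sign ∧ d.sign = a.sign := by
    rcases pos_and_pos_or_neg_and_neg_of_mul_pos (h ▸ hn) with ⟨h1, h2⟩ | ⟨h1, h2⟩
    · rw [Int.sign_eq_one_of_pos h1, Int.sign_eq_one_of_pos h2, Int.sign_eq_one_of_pos (by linarith)]
      simp
    · rw [Int.sign_eq_neg_one_of_neg h1, Int.sign_eq_neg_one_of_neg h2, Int.sign_eq_neg_one_of_neg (by linarith)]
      simp
  unfold root2 rho
  simp only [mul_zero, zero_mul, lt_irrefl, if_false, add_zero, zero_add, sub_zero, zero_sub]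
  rw [mul_comm (b - a + d) b, show b + d - (a - b) = b + (b - a + d) by ring,
    show b + d + (a - b) = a + d by ring, show b - (b - a + d) = a - d by ring, add_comm d a]
  simp only [Int.sign_mul, key.1, sg_neg']
  split_ifs with h1
  · rcases pos_and_pos_or_neg_and_neg_of_mul_pos h1 with ⟨h1, h2⟩ | ⟨h1, h2⟩
    · rw [Int.sign_eq_one_of_pos h1, Int.sign_eq_one_of_pos h2,
        Int.sign_eq_one_of_pos (show 0 < b + (b - a + d) by linarith)]
      ring
    · rw [Int.sign_eq_neg_one_of_neg h1, Int.sign_eq_neg_one_of_neg h2,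
        Int.sign_eq_neg_one_of_neg (show b + (b - a + d) < 0 by linarith)]
      ring
  · ring

def qq (b z : ℤ) : ℤ := if b = 0 then (if z = 0 then 2 else 3) else (if z = 0 then 3 else 6)

def kap (a b c d : ℤ) : ℤ := if c = 0 then qq b (b + c - a + d) * root2 a b c d else 0

lemma kap_sum (a b c d : ℤ) :
    6 * (if b = 0 ∨ c = 0 ∨ b + c - a + d = 0 then root2 a b c d else 0) =
    kap a b c d + kap (c + d) c (b + c - a + d) (a - c) + kap (b + d) (b + c - a + d) b (a - b) := by
  unfold kap
  rw [root2_U, root2_U2, show c + (b + c - a + d) - (c + d) + (a - c) = b by ring,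
    show b + c - a + d + b - (b + d) + (a - b) = c by ring]
  unfold qq
  generalize root2 a b c d = R
  generalize b + c - a + d = z
  by_cases hb : b = 0 <;> by_cases hc : c = 0 <;> by_cases hz : z = 0 <;>
    simp only [hb, hc, hz, if_true, if_false, or_true, true_or, or_self] <;> ring

lemma kap_pair {n a b d : ℤ} (hn : 0 < n) (h : a * d = n) :
    kap a b 0 d + kap d (b - a + d) 0 a =
      (-6) * |(b - a + d).sign - b.sign| - 4 * (if b = 0 ∧ a = d then 1 else 0) := by
  have hs : d.sign = a.sign := by
    rcases pos_and_pos_or_neg_and_neg_of_mul_pos (h ▸ hn) with ⟨h1, h2⟩ | ⟨h1, h2⟩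
    · rw [Int.sign_eq_one_of_pos h1, Int.sign_eq_one_of_pos h2]
    · rw [Int.sign_eq_neg_one_of_neg h1, Int.sign_eq_neg_one_of_neg h2]
  unfold kap
  rw [if_pos rfl, if_pos rfl, root2_c hn h, root2_c hn (show d * a = n by linarith),
    show b - a + d - d + a = b by ring, show b - a + d + 0 - d + a = b by ring, add_zero,
    mul_comm (b - a + d) b, ← neg_sub a d, sg_neg', hs]
  obtain ⟨z, hz⟩ : ∃ z, z = b - a + d := ⟨_, rfl⟩
  have hm : (b = 0 ∧ a = d) ↔ (b = 0 ∧ z = 0) := by omega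
  rw [if_congr hm rfl rfl]
  rw [← hz]
  unfold qq
  rcases sgn3 z with ⟨h1, h1'⟩ | ⟨h1, h1'⟩ | ⟨h1, h1'⟩ <;>
  rcases sgn3 b with ⟨h2, h2'⟩ | ⟨h2, h2'⟩ | ⟨h2, h2'⟩ <;>
  rw [h1', h2']
  · have hp := mul_pos h2 h1
    simp [hp, h1.ne', h2.ne']
  · subst h2; simp [h1.ne']; ring
  · have hp := not_lt.mpr (mul_neg_of_neg_of_pos h2 h1).le
    simp only [hp, if_false]
    simp [h1.ne', h2.ne]; ring
  · subst h1; simp [h2.ne']; ring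
  · subst h1; subst h2; simp; ring
  · subst h1; simp [h2.ne]; ring
  · have hp := not_lt.mpr (mul_neg_of_pos_of_neg h2 h1).le
    simp only [hp, if_false]
    simp [h1.ne, h2.ne']; ring
  · subst h2; simp [h1.ne]; ring
  · have hp := mul_pos_of_neg_of_neg h2 h1
    simp [hp, h1.ne, h2.ne]


def eC : (ℤ × ℤ × ℤ × ℤ) ≃ (ℤ × ℤ × ℤ × ℤ) where
  toFun v := (v.2.2.1, v.1, v.2.2.2, v.2.1)
  invFun v := (v.2.1, v.2.2.2, v.1, v.2.2.1)
  left_inv _ := rfl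
  right_inv _ := rfl

lemma Sm_fibc {n : ℤ} (hn : n ≠ 0) (f : ℤ → ℤ → ℤ → ℤ)
    (hf : FS n (fun a b c d => if c = 0 then f a b d else 0)) :
    Sm n (fun a b c d => if c = 0 then f a b d else 0) =
      ∑ p ∈ Int.divisorsAntidiag n, ∑ᶠ b, f p.1 b p.2 := by
  rw [← Sm_fib hn (fun a d b => f a b d)]
  · apply Sm_equiv eC
    rintro ⟨a, b, c, d⟩
    simp only [ext4, eC, Equiv.coe_fn_mk]
    exact if_congr (by constructor <;> intro h <;> linarith) rfl rfl
  · obtain ⟨K, hK⟩ := hf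
    refine ⟨K, fun a b c d h1 h2 => ?_⟩
    have := hK b d a c (by linarith) h2
    tauto

lemma sum_abs_sgn (m : ℤ) : ∑ᶠ b : ℤ, |(b + m).sign - b.sign| = 2 * |m| := by
  rcases le_total 0 m with h | h
  · rw [abs_of_nonneg h, ← sum_sgn]
    apply finsum_congr; intro b
    apply abs_of_nonneg
    rcases sgn3 (b + m) with ⟨h1, h1'⟩ | ⟨h1, h1'⟩ | ⟨h1, h1'⟩ <;>
    rcases sgn3 b with ⟨h2, h2'⟩ | ⟨h2, h2'⟩ | ⟨h2, h2'⟩ <;> rw [h1', h2'] <;> omega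
  · rw [abs_of_nonpos h, mul_neg, ← sum_sgn, ← finsum_neg_distrib]
    apply finsum_congr; intro b
    apply abs_of_nonpos
    rcases sgn3 (b + m) with ⟨h1, h1'⟩ | ⟨h1, h1'⟩ | ⟨h1, h1'⟩ <;>
    rcases sgn3 b with ⟨h2, h2'⟩ | ⟨h2, h2'⟩ | ⟨h2, h2'⟩ <;> rw [h1', h2'] <;> omega

lemma cusp {n : ℤ} (hn : 0 < n) (φ : ℤ → ℤ) :
    Sm n (fun a b c d => if b = 0 ∨ c = 0 ∨ b + c - a + d = 0 then φ (a + d) * root2 a b c d else 0)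
     = - ∑ p ∈ Int.divisorsAntidiag n, φ (p.1 + p.2) *
        (3 * |p.1 - p.2| + if p.1 = p.2 then 1 else 0) := by
  have fr := FS_root2 hn
  have fk : FS n kap := ((fr.mul (fun a b c d => qq b (b + c - a + d))).ite (fun a b c d => c = 0))
  have fk' := fk.mul (fun a b c d => φ (a + d))
  have e1 : 6 * Sm n (fun a b c d => if b = 0 ∨ c = 0 ∨ b + c - a + d = 0 then φ (a + d) * root2 a b c d else 0)
      = 3 * Sm n (fun a b c d => φ (a + d) * kap a b c d) := by
    rw [← Sm_mul 6 ((fr.mul (fun a b c d => φ (a + d))).ite _)]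
    have h1 := Sm_U n (fun a b c d => φ (a + d) * kap a b c d)
    have h2 := Sm_U2 n (fun a b c d => φ (a + d) * kap a b c d)
    have h3 := Sm_add (fk'.add fk'.U) fk'.U2
    rw [Sm_add fk' fk'.U, h1, h2] at h3
    rw [show (3:ℤ) * Sm n (fun a b c d => φ (a + d) * kap a b c d) = Sm n (fun a b c d => φ (a + d) * kap a b c d) + Sm n (fun a b c d => φ (a + d) * kap a b c d) + Sm n (fun a b c d => φ (a + d) * kap a b c d) by ring, ← h3]
    apply Sm_congr
    intro a b c d _
    have := kap_sum a b c d
    rw [show c + d + (a - c) = a + d by ring, show b + d + (a - b) = a + d by ring, ← mul_add, ← mul_add, ← this]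
    split_ifs <;> ring
  have e2 : Sm n (fun a b c d => φ (a + d) * kap a b c d) =
      Sm n (fun a b c d => if c = 0 then φ (a + d) * kap a b 0 d else 0) := by
    apply Sm_congr
    intro a b c d _
    split_ifs with h
    · rw [h]
    · simp [kap, h]
  have fk2 : FS n (fun a b c d => if c = 0 then φ (a + d) * kap a b 0 d else 0) := by
    apply fk'.congr
    intro a b c d _
    split_ifs with h
    · rw [h]
    · simp [kap, h]
  have e3 := Sm_V n (fun a b d => φ (a + d) * kap a b 0 d)
  have fk3 : FS n (fun a b c d => if c = 0 then φ (d + a) * kap d (b - a + d) 0 a else 0) := by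
    obtain ⟨K, hK⟩ := fk2
    refine ⟨3 * K, fun a b c d h1 h2 => ?_⟩
    by_cases hc : c = 0
    · subst hc
      have := hK d (b - a + d) 0 a (by linarith) h2
      simp only [abs_le] at *
      omega
    · simp [hc] at h2
  have e4 := Sm_add fk2 fk3
  have e5 : Sm n (fun a b c d => (if c = 0 then φ (a + d) * kap a b 0 d else 0) + (if c = 0 then φ (d + a) * kap d (b - a + d) 0 a else 0)) =
     Sm n (fun a b c d => if c = 0 then φ (a + d) * ((-6) * |(b - a + d).sign - b.sign| - 4 * (if b = 0 ∧ a = d then 1 else 0)) else 0) := by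
    apply Sm_congr
    intro a b c d h
    by_cases hc : c = 0
    · subst hc
      have := kap_pair (b := b) hn (show a * d = n by linarith)
      simp only [if_true]
      rw [← this, add_comm d a, mul_add]
    · simp [hc]
  have f5 : FS n (fun a b c d => if c = 0 then φ (a + d) * ((-6) * |(b - a + d).sign - b.sign| - 4 * (if b = 0 ∧ a = d then 1 else 0)) else 0) := by
    apply (fk2.add fk3).congr
    intro a b c d h
    by_cases hc : c = 0
    · subst hc
      have := kap_pair (b := b) hn (show a * d = n by linarith)
      simp only [if_true]
      rw [← this, add_comm d a, mul_add]
    · simp [hc]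
  have e6 := Sm_fibc hn.ne' (fun a b d => φ (a + d) * ((-6) * |(b - a + d).sign - b.sign| - 4 * (if b = 0 ∧ a = d then 1 else 0))) f5
  have e7 : ∀ p ∈ Int.divisorsAntidiag n, ∑ᶠ b, (φ (p.1 + p.2) * ((-6) * |(b - p.1 + p.2).sign - b.sign| - 4 * (if b = 0 ∧ p.1 = p.2 then 1 else 0))) = (-4) * (φ (p.1 + p.2) *
        (3 * |p.1 - p.2| + if p.1 = p.2 then 1 else 0)) := by
    intro p _
    have s1 : (Function.support (fun b : ℤ => |(b - p.1 + p.2).sign - b.sign|)).Finite := by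
      refine (fin_sgn (p.2 - p.1)).subset ?_
      intro b hb
      simp only [Function.mem_support, ne_eq, abs_eq_zero] at hb ⊢
      rwa [show b + (p.2 - p.1) = b - p.1 + p.2 by ring]
    have s2 : (Function.support (fun b : ℤ => if b = 0 ∧ p.1 = p.2 then (1:ℤ) else 0)).Finite := by
      refine (Set.finite_singleton 0).subset ?_
      intro b hb
      simp only [Function.mem_support] at hb
      by_contra h
      simp at h
      simp [h] at hb
    have s3 : (Function.support (fun b : ℤ => (-6) * |(b - p.1 + p.2).sign - b.sign|)).Finite :=
      s1.subset (Function.support_mul_subset_right _ _)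
    have s4 : (Function.support (fun b : ℤ => 4 * if b = 0 ∧ p.1 = p.2 then (1:ℤ) else 0)).Finite :=
      s2.subset (Function.support_mul_subset_right _ _)
    rw [← mul_finsum', finsum_sub_distrib s3 s4, ← mul_finsum' _ _ s1, ← mul_finsum' _ _ s2]
    · have := sum_abs_sgn (p.2 - p.1)
      rw [abs_sub_comm] at this
      rw [show (∑ᶠ b : ℤ, |(b - p.1 + p.2).sign - b.sign|) = 2 * |p.1 - p.2| by
        rw [← this]; apply finsum_congr; intro b; rw [show b + (p.2 - p.1) = b - p.1 + p.2 by ring]]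
      rw [finsum_eq_single _ (0 : ℤ) (by intro b hb; simp [hb])]
      simp only [true_and]
      ring
    · exact (s3.union s4).subset (Function.support_sub _ _)
  rw [Finset.sum_congr rfl e7, ← Finset.mul_sum] at e6
  rw [← e5, e4, e3] at e6
  linarith


lemma w2_ne {A B C : ℤ} (hA : 0 < A) (hD : B ^ 2 - 4 * A * C < 0) (h : w2 A B C ≠ 0) :
    0 ≤ 2 * A + B ∧ 0 ≤ 2 * C + B ∧ B ≤ 0 := by
  obtain ⟨h1, h2⟩ := ell_pos hA hD
  unfold w2 at h
  rcases sgn3 (2 * A + B) with ⟨h1, h1'⟩ | ⟨h1, h1'⟩ | ⟨h1, h1'⟩ <;>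
  rcases sgn3 (2 * C + B) with ⟨h2, h2'⟩ | ⟨h2, h2'⟩ | ⟨h2, h2'⟩ <;>
  rcases sgn3 (-B) with ⟨h3, h3'⟩ | ⟨h3, h3'⟩ | ⟨h3, h3'⟩ <;>
  rw [h1', h2', h3'] at h <;> omega

lemma red_bd {P Q R N : ℤ} (hP : 0 ≤ P) (hQ : 0 ≤ Q) (hR : 0 ≤ R) (hN : 0 < N)
    (h : P * Q + Q * R + R * P = N) : P ≤ N := by
  have h1 : 0 < Q + R := by
    by_contra h1
    have : Q = 0 := by omega
    have : R = 0 := by omega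
    subst Q; subst R; simp at h; omega
  have := mul_nonneg hQ hR
  nlinarith

lemma wF_fin {N : ℤ} (hN : 0 < N) : (Function.support (wF N)).Finite := by
  refine Set.Finite.subset ((Set.finite_Icc (-N) N).prod ((Set.finite_Icc (-N) N).prod
    (Set.finite_Icc (-N) N))) ?_
  rintro ⟨A, B, C⟩ hv
  simp only [Function.mem_support, wF] at hv
  split_ifs at hv with h
  · obtain ⟨h1, h2⟩ := h
    simp only [formDisc] at h1 h2
    obtain ⟨h3, h4, h5⟩ := w2_ne h2 (by linarith) hv
    have e : (2 * A + B) * (2 * C + B) + (2 * C + B) * (-B) + (-B) * (2 * A + B) = N := by linarith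
    have b1 := red_bd h3 h4 (by linarith) hN e
    have b2 := red_bd h4 h3 (show 0 ≤ -B by linarith) hN (by linarith)
    have b3 := red_bd (show 0 ≤ -B by linarith) h4 h3 hN (by linarith)
    simp only [Set.mem_prod, Set.mem_Icc]
    omega
  · exact absurd rfl hv

lemma finsum_inj {α β : Type*} (f : β → ℤ) (g : α → β) (hg : Function.Injective g)
    (hs : Function.support f ⊆ Set.range g) : ∑ᶠ x, f (g x) = ∑ᶠ y, f y := by
  rw [← finsum_mem_range hg, ← finsum_mem_univ f]
  apply finsum_mem_inter_support_eq
  ext y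
  constructor
  · rintro ⟨_, h⟩; exact ⟨trivial, h⟩
  · rintro ⟨_, h⟩; exact ⟨hs h, h⟩

lemma wF_par {n t A B C : ℤ} (h : wF (4 * n - t ^ 2) (A, B, C) ≠ 0) : ∃ d, B = 2 * d - t := by
  unfold wF at h
  split_ifs at h with h1
  · have h2 := h1.1
    simp only [formDisc] at h2
    have h3 : Even (B ^ 2 - t ^ 2) := ⟨2 * A * C - 2 * n, by linarith⟩
    have h4 : Even (B + t) := by
      rw [Int.even_sub, Int.even_pow' two_ne_zero, Int.even_pow' two_ne_zero] at h3
      exact Int.even_add.mpr h3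
    obtain ⟨d, hd⟩ := h4
    exact ⟨d, by omega⟩
  · exact absurd rfl h

lemma wF_t1 (n t : ℤ) : ∑ᶠ x : ℤ × ℤ × ℤ, wF (4 * n - t ^ 2) (x.2.1, 2 * x.2.2 - t, x.1) =
    ∑ᶠ Q, wF (4 * n - t ^ 2) Q := by
  apply finsum_inj (wF (4 * n - t ^ 2)) (fun x : ℤ × ℤ × ℤ => (x.2.1, 2 * x.2.2 - t, x.1))
  · rintro ⟨b, c, d⟩ ⟨b', c', d'⟩ h
    simp only [Prod.mk.injEq] at h ⊢
    omega
  · rintro ⟨A, B, C⟩ h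
    obtain ⟨d, hd⟩ := wF_par h
    exact ⟨(C, A, d), by simp [hd]⟩

lemma wF_t2 (n t : ℤ) : ∑ᶠ x : ℤ × ℤ × ℤ, wF (4 * n - t ^ 2) (-x.2.1, t - 2 * x.2.2, -x.1) =
    ∑ᶠ Q, wF (4 * n - t ^ 2) Q := by
  apply finsum_inj (wF (4 * n - t ^ 2)) (fun x : ℤ × ℤ × ℤ => (-x.2.1, t - 2 * x.2.2, -x.1))
  · rintro ⟨b, c, d⟩ ⟨b', c', d'⟩ h
    simp only [Prod.mk.injEq] at h ⊢
    omega
  · rintro ⟨A, B, C⟩ h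
    obtain ⟨d, hd⟩ := wF_par h
    exact ⟨(-C, -A, t - d), by simp [hd]; ring⟩

def eT : (ℤ × ℤ × ℤ × ℤ) ≃ (ℤ × ℤ × ℤ × ℤ) where
  toFun v := (v.1 - v.2.2.2, v.2.1, v.2.2.1, v.2.2.2)
  invFun v := (v.1 + v.2.2.2, v.2.1, v.2.2.1, v.2.2.2)
  left_inv _ := by simp
  right_inv _ := by simp

lemma ell {n : ℤ} (hn : 0 < n) (φ : ℤ → ℤ) :
    Sm n (fun a b c d => if (a + d) ^ 2 < 4 * n then φ (a + d) * root2 a b c d else 0) =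
    ∑ᶠ t : ℤ, if t ^ 2 < 4 * n then φ t * (2 * ∑ᶠ Q, wF (4 * n - t ^ 2) Q) else 0 := by
  have fr := ((FS_root2 hn).mul (fun a b c d => φ (a + d))).ite (fun a b c d => (a + d) ^ 2 < 4 * n)
  unfold Sm
  rw [← finsum_comp_equiv eT, finsum_curry _ (fr.supp.preimage eT.injective.injOn)]
  apply finsum_congr
  intro t
  split_ifs with ht
  · have hN : 0 < 4 * n - t ^ 2 := by linarith
    have g1 := wF_t1 n t
    have g2 := wF_t2 n t
    have s1 : (Function.support (fun x : ℤ × ℤ × ℤ => wF (4 * n - t ^ 2) (x.2.1, 2 * x.2.2 - t, x.1))).Finite := by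
      refine (wF_fin hN).preimage (f := fun x : ℤ × ℤ × ℤ => (x.2.1, 2 * x.2.2 - t, x.1)) ?_
      rintro ⟨b, c, d⟩ _ ⟨b', c', d'⟩ _ h
      simp only [Prod.mk.injEq] at h ⊢
      omega
    have s2 : (Function.support (fun x : ℤ × ℤ × ℤ => wF (4 * n - t ^ 2) (-x.2.1, t - 2 * x.2.2, -x.1))).Finite := by
      refine (wF_fin hN).preimage (f := fun x : ℤ × ℤ × ℤ => (-x.2.1, t - 2 * x.2.2, -x.1)) ?_
      rintro ⟨b, c, d⟩ _ ⟨b', c', d'⟩ _ h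
      simp only [Prod.mk.injEq] at h ⊢
      omega
    have g3 := finsum_add_distrib s1 s2
    rw [g1, g2, ← two_mul] at g3
    rw [← g3, mul_finsum']
    · apply finsum_congr
      rintro ⟨b, c, d⟩
      simp only [ext4, eT, Equiv.coe_fn_mk, sub_add_cancel]
      split_ifs with h
      · rw [root2_ell h (by simpa using ht)]
        congr 3
        · simp
        · congr 2; ring
        · simp
        · congr 2; ring
      · have : ∀ Q, formDisc Q ≠ -(4 * n - t ^ 2) → wF (4 * n - t ^ 2) Q = 0 := by
          intro Q hQ; unfold wF; rw [if_neg (by tauto)]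
        rw [this, this]
        · simp
        · simp only [formDisc]; intro h'; apply h; linarith
        · simp only [formDisc]; intro h'; apply h; linarith
    · exact (s1.union s2).subset (Function.support_add _ _)
  · apply finsum_eq_zero_of_forall_eq_zero
    rintro ⟨b, c, d⟩
    simp only [ext4, eT, Equiv.coe_fn_mk, sub_add_cancel, ht, if_false, ite_self]

lemma split {n : ℤ} (hn : 0 < n) (φ : ℤ → ℤ) :
    Sm n (fun a b c d => φ (a + d) * root2 a b c d) =
    (∑ᶠ t : ℤ, if t ^ 2 < 4 * n then φ t * (2 * ∑ᶠ Q, wF (4 * n - t ^ 2) Q) else 0)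
     - ∑ p ∈ Int.divisorsAntidiag n, φ (p.1 + p.2) *
        (3 * |p.1 - p.2| + if p.1 = p.2 then 1 else 0) := by
  have fr := (FS_root2 hn).mul (fun a b c d => φ (a + d))
  rw [← ell hn, sub_eq_add_neg, ← cusp hn, ← Sm_add (fr.ite _) (fr.ite _)]
  apply Sm_congr
  intro a b c d h
  by_cases ht : (a + d) ^ 2 < 4 * n
  · rw [if_pos ht, if_neg, add_zero]
    have : (a - d) ^ 2 - 4 * b * c < 0 := by linarith
    rintro (h | h | h)
    · subst h; nlinarith [sq_nonneg (a - d)]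
    · subst h; nlinarith [sq_nonneg (a - d)]
    · have h5 : a - d = b + c := by linarith
      rw [h5] at this
      nlinarith [sq_nonneg (b - c)]
  · rw [if_neg ht]
    split_ifs with h1
    · simp
    · push Not at h1
      rw [root2_hyp h1.1 h1.2.1 h1.2.2 (by linarith)]; simp


abbrev SG := Matrix.SpecialLinearGroup (Fin 2) ℤ

def smk (p q r s : ℤ) (h : p * s - q * r = 1) : SG :=
  ⟨!![p, q; r, s], by rw [Matrix.det_fin_two_of, h]⟩

lemma det_eq (γ : SG) : γ.1 0 0 * γ.1 1 1 - γ.1 0 1 * γ.1 1 0 = 1 := by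
  rw [← Matrix.det_fin_two]; exact γ.2

lemma formAct_eq (γ : SG) (A B C : ℤ) : formAct γ (A, B, C) =
    (A * γ.1 0 0 ^ 2 + B * γ.1 0 0 * γ.1 1 0 + C * γ.1 1 0 ^ 2,
     2 * A * γ.1 0 0 * γ.1 0 1 + B * (γ.1 0 0 * γ.1 1 1 + γ.1 0 1 * γ.1 1 0) + 2 * C * γ.1 1 0 * γ.1 1 1,
     A * γ.1 0 1 ^ 2 + B * γ.1 0 1 * γ.1 1 1 + C * γ.1 1 1 ^ 2) := by
  simp only [formAct, formEval, Prod.mk.injEq]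
  refine ⟨trivial, ?_, trivial⟩
  ring

lemma formAct_smk (p q r s : ℤ) (h : p * s - q * r = 1) (A B C : ℤ) :
    formAct (smk p q r s h) (A, B, C) =
    (A * p ^ 2 + B * p * r + C * r ^ 2,
     2 * A * p * q + B * (p * s + q * r) + 2 * C * r * s,
     A * q ^ 2 + B * q * s + C * s ^ 2) := by
  rw [formAct_eq]; simp [smk]

lemma formAct_one (Q : ℤ × ℤ × ℤ) : formAct 1 Q = Q := by
  obtain ⟨A, B, C⟩ := Q
  rw [formAct_eq]; simp

lemma formAct_mul (γ δ : SG) (Q : ℤ × ℤ × ℤ) : formAct γ (formAct δ Q) = formAct (δ * γ) Q := by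
  obtain ⟨A, B, C⟩ := Q
  rw [formAct_eq δ, formAct_eq, formAct_eq]
  simp only [Matrix.SpecialLinearGroup.coe_mul, Matrix.mul_apply, Fin.sum_univ_two, Prod.mk.injEq]
  refine ⟨?_, ?_, ?_⟩ <;> ring

lemma formAct_disc (γ : SG) (Q : ℤ × ℤ × ℤ) : formDisc (formAct γ Q) = formDisc Q := by
  obtain ⟨A, B, C⟩ := Q
  rw [formAct_eq]
  simp only [formDisc]
  have h := det_eq γ
  have : (γ.1 0 0 * γ.1 1 1 - γ.1 0 1 * γ.1 1 0) ^ 2 * (B ^ 2 - 4 * A * C) = B ^ 2 - 4 * A * C := by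
    rw [h]; ring
  rw [← this]; ring

lemma formAct_pos (γ : SG) (Q : ℤ × ℤ × ℤ) (h : IsPosDef Q) : IsPosDef (formAct γ Q) := by
  refine ⟨?_, by rw [formAct_disc]; exact h.2⟩
  obtain ⟨A, B, C⟩ := Q
  have h1 := h.1
  have h2 := h.2
  simp only [formDisc] at h1 h2
  rw [formAct_eq]
  simp only
  have hd := det_eq γ
  generalize γ.1 0 0 = p at *
  generalize γ.1 1 0 = r at *
  generalize γ.1 0 1 = q at *
  generalize γ.1 1 1 = s at *
  have e : 4 * A * (A * p ^ 2 + B * p * r + C * r ^ 2) = (2 * A * p + B * r) ^ 2 + (4 * A * C - B ^ 2) * r ^ 2 := by ring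
  have : 0 < 4 * A * (A * p ^ 2 + B * p * r + C * r ^ 2) := by
    by_cases hr : r = 0
    · subst hr
      have hp : p ≠ 0 := by rintro rfl; simp at hd
      have : 0 < p ^ 2 := by positivity
      have : 0 < A * p ^ 2 := mul_pos h1 this
      nlinarith
    · rw [e]
      have : 0 < r ^ 2 := by positivity
      have := mul_pos (show 0 < 4 * A * C - B ^ 2 by linarith) this
      positivity
  exact (mul_pos_iff_of_pos_left (by linarith)).mp this

def ftr (Q : ℤ × ℤ × ℤ) : ℤ := 2 * Q.1 + 2 * Q.2.2 + Q.2.1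

lemma hx {x y : ℤ} (h : ¬(x = 0 ∧ y = 0)) : 1 ≤ x ^ 2 + x * y + y ^ 2 := by
  by_contra h1
  have h2 : 0 ≤ (2 * x + y) ^ 2 + 3 * y ^ 2 := by positivity
  have h4 : y ^ 2 ≤ 0 := by nlinarith [sq_nonneg (2 * x + y)]
  have h5 : y = 0 := by
    have := sq_nonneg y
    exact pow_eq_zero_iff (two_ne_zero) |>.mp (by linarith)
  subst h5
  apply h
  refine ⟨?_, rfl⟩
  exact pow_eq_zero_iff (two_ne_zero) |>.mp (by nlinarith [sq_nonneg x])

lemma hx1 {x y : ℤ} (h : x ^ 2 + x * y + y ^ 2 = 1) :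
    (x, y) ∈ ({(1, 0), (-1, 0), (0, 1), (0, -1), (1, -1), (-1, 1)} : Finset (ℤ × ℤ)) := by
  have h1 : x ^ 2 ≤ 1 := by nlinarith [sq_nonneg (2 * y + x)]
  have h2 : y ^ 2 ≤ 1 := by nlinarith [sq_nonneg (2 * x + y)]
  have h3 := abs_le.mp ((sq_le_one_iff_abs_le_one x).mp h1)
  have h4 := abs_le.mp ((sq_le_one_iff_abs_le_one y).mp h2)
  obtain ⟨a, b⟩ := h3
  obtain ⟨c, d⟩ := h4
  interval_cases x <;> interval_cases y <;> first | (exfalso; omega) | decide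

lemma ftr_formula (A B C p q r s : ℤ) (γ : SG) (h1 : γ.1 0 0 = p) (h2 : γ.1 0 1 = q)
    (h3 : γ.1 1 0 = r) (h4 : γ.1 1 1 = s) : ftr (formAct γ (A, B, C)) =
    (2 * A + B) * (p ^ 2 + p * q + q ^ 2) + (2 * C + B) * (r ^ 2 + r * s + s ^ 2) +
    (-B) * ((p - r) ^ 2 + (p - r) * (q - s) + (q - s) ^ 2) := by
  rw [formAct_eq]; simp only [ftr, h1, h2, h3, h4]; ring

lemma ftr_le {A B C : ℤ} (h1 : 0 ≤ 2 * A + B) (h2 : 0 ≤ 2 * C + B) (h3 : B ≤ 0) (γ : SG) :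
    ftr (A, B, C) ≤ ftr (formAct γ (A, B, C)) := by
  rw [ftr_formula A B C _ _ _ _ γ rfl rfl rfl rfl]
  have hd := det_eq γ
  generalize γ.1 0 0 = p at *
  generalize γ.1 1 0 = r at *
  generalize γ.1 0 1 = q at *
  generalize γ.1 1 1 = s at *
  have k1 : 1 ≤ p ^ 2 + p * q + q ^ 2 := hx (by rintro ⟨rfl, rfl⟩; simp at hd)
  have k2 : 1 ≤ r ^ 2 + r * s + s ^ 2 := hx (by rintro ⟨rfl, rfl⟩; simp at hd)
  have k3 : 1 ≤ (p - r) ^ 2 + (p - r) * (q - s) + (q - s) ^ 2 := hx (by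
    rintro ⟨h, h'⟩
    rw [show p = r by linarith, show q = s by linarith] at hd
    simp [mul_comm] at hd)
  have := mul_le_mul_of_nonneg_left k1 h1
  have := mul_le_mul_of_nonneg_left k2 h2
  have := mul_le_mul_of_nonneg_left k3 (show 0 ≤ -B by linarith)
  simp only [ftr]
  linarith

lemma hexa {A B C : ℤ} (h1 : 0 < 2 * A + B) (h2 : 0 < 2 * C + B) (h3 : B ≤ 0) (γ : SG)
    (h : ftr (formAct γ (A, B, C)) ≤ ftr (A, B, C)) :
    γ.1 0 0 ^ 2 + γ.1 0 0 * γ.1 0 1 + γ.1 0 1 ^ 2 = 1 ∧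
    γ.1 1 0 ^ 2 + γ.1 1 0 * γ.1 1 1 + γ.1 1 1 ^ 2 = 1 := by
  rw [ftr_formula A B C _ _ _ _ γ rfl rfl rfl rfl] at h
  have hd := det_eq γ
  generalize γ.1 0 0 = p at *
  generalize γ.1 1 0 = r at *
  generalize γ.1 0 1 = q at *
  generalize γ.1 1 1 = s at *
  have k1 : 1 ≤ p ^ 2 + p * q + q ^ 2 := hx (by rintro ⟨rfl, rfl⟩; simp at hd)
  have k2 : 1 ≤ r ^ 2 + r * s + s ^ 2 := hx (by rintro ⟨rfl, rfl⟩; simp at hd)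
  have k3 : 1 ≤ (p - r) ^ 2 + (p - r) * (q - s) + (q - s) ^ 2 := hx (by
    rintro ⟨h, h'⟩
    rw [show p = r by linarith, show q = s by linarith] at hd
    simp [mul_comm] at hd)
  have m1 := mul_le_mul_of_nonneg_left k1 h1.le
  have m2 := mul_le_mul_of_nonneg_left k2 h2.le
  have m3 := mul_le_mul_of_nonneg_left k3 (show 0 ≤ -B by linarith)
  simp only [ftr] at h
  constructor
  · apply le_antisymm _ k1
    by_contra hh
    have := mul_le_mul_of_nonneg_left (show 2 ≤ p ^ 2 + p * q + q ^ 2 by linarith) h1.le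
    linarith
  · apply le_antisymm _ k2
    by_contra hh
    have := mul_le_mul_of_nonneg_left (show 2 ≤ r ^ 2 + r * s + s ^ 2 by linarith) h2.le
    linarith

/-- every positive definite form is equivalent to a reduced one -/
lemma exists_red (Q : ℤ × ℤ × ℤ) (hQ : IsPosDef Q) : ∃ γ : SG, ∃ A B C, formAct γ Q = (A, B, C) ∧
    0 < 2 * A + B ∧ 0 < 2 * C + B ∧ B ≤ 0 := by
  classical
  have hpos : ∀ γ : SG, 0 < ftr (formAct γ Q) := by
    intro γ
    obtain ⟨h1, h2⟩ := formAct_pos γ Q hQ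
    simp only [formDisc] at h2
    have := ell_pos h1 h2
    simp only [ftr]; linarith
  have hex : ∃ k : ℕ, ∃ γ : SG, ftr (formAct γ Q) = k := ⟨(ftr (formAct 1 Q)).toNat, 1, by
    rw [Int.toNat_of_nonneg (hpos 1).le]⟩
  obtain ⟨γ, hγ⟩ := Nat.find_spec hex
  have hmin : ∀ δ : SG, ftr (formAct γ Q) ≤ ftr (formAct δ (formAct γ Q)) := by
    intro δ
    rw [formAct_mul, hγ]
    have := Nat.find_min' hex (m := (ftr (formAct (γ * δ) Q)).toNat) ⟨γ * δ, by
      rw [Int.toNat_of_nonneg (hpos _).le]⟩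
    have h2 := Int.toNat_of_nonneg (hpos (γ * δ)).le
    omega
  obtain ⟨h1, h2⟩ := formAct_pos γ Q hQ
  obtain ⟨⟨A, B, C⟩, hF⟩ : ∃ F, F = formAct γ Q := ⟨_, rfl⟩
  rw [← hF] at hmin h1 h2
  simp only [formDisc] at h1 h2
  have hp := ell_pos h1 h2
  have a1 := hmin (smk 0 (-1) 1 0 (by norm_num))
  have a2 := hmin (smk 1 1 0 1 (by norm_num))
  have a3 := hmin (smk 1 0 1 1 (by norm_num))
  rw [formAct_smk] at a1 a2 a3
  simp only [ftr] at a1 a2 a3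
  have b1 : B ≤ 0 := by linarith
  have b2 : 0 ≤ 2 * A + B := by linarith
  have b3 : 0 ≤ 2 * C + B := by linarith
  by_cases c1 : 2 * A + B = 0
  · refine ⟨γ * smk 1 (-1) 1 0 (by norm_num), A + B + C, -(2 * A + B), A, ?_, ?_, ?_, ?_⟩
    · rw [← formAct_mul, ← hF, formAct_smk]
      simp only [Prod.mk.injEq]
      refine ⟨?_, ?_, ?_⟩ <;> ring
    all_goals omega
  by_cases c2 : 2 * C + B = 0
  · refine ⟨γ * smk 0 (-1) 1 (-1) (by norm_num), C, -(2 * C + B), A + B + C, ?_, ?_, ?_, ?_⟩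
    · rw [← formAct_mul, ← hF, formAct_smk]
      simp only [Prod.mk.injEq]
      refine ⟨?_, ?_, ?_⟩ <;> ring
    all_goals omega
  exact ⟨γ, A, B, C, hF.symm, by omega, by omega, b1⟩


lemma w2_val {A B C x y z : ℤ} (hx : (2 * A + B).sign = x) (hy : (2 * C + B).sign = y) (hz : (-B).sign = z) :
    w2 A B C = x + y + z - 1 := by
  unfold w2; rw [hx, hy, hz]

def wv (A B C : ℤ) (v : ℤ × ℤ × ℤ × ℤ) : ℤ :=
  if v.1 * v.2.2.2 - v.2.1 * v.2.2.1 = 1 then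
    w2 (A * v.1 ^ 2 + B * v.1 * v.2.2.1 + C * v.2.2.1 ^ 2)
     (2 * A * v.1 * v.2.1 + B * (v.1 * v.2.2.2 + v.2.1 * v.2.2.1) + 2 * C * v.2.2.1 * v.2.2.2)
     (A * v.2.1 ^ 2 + B * v.2.1 * v.2.2.2 + C * v.2.2.2 ^ 2) else 0

def sent (γ : SG) : ℤ × ℤ × ℤ × ℤ := (γ.1 0 0, γ.1 0 1, γ.1 1 0, γ.1 1 1)

lemma sent_inj : Function.Injective sent := by
  intro γ δ h
  simp only [sent, Prod.mk.injEq] at h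
  ext i j
  fin_cases i <;> fin_cases j <;> simp [h]

def hexs : Finset (ℤ × ℤ × ℤ × ℤ) :=
  {(1, 0, 0, 1), (1, 0, -1, 1), (-1, 0, 0, -1), (-1, 0, 1, -1),
   (0, 1, -1, 0), (0, 1, -1, 1), (0, -1, 1, 0), (0, -1, 1, -1),
   (1, -1, 1, 0), (1, -1, 0, 1), (-1, 1, -1, 0), (-1, 1, 0, -1)}

lemma hexs_mem : ∀ u ∈ ({(1, 0), (-1, 0), (0, 1), (0, -1), (1, -1), (-1, 1)} : Finset (ℤ × ℤ)),
    ∀ v ∈ ({(1, 0), (-1, 0), (0, 1), (0, -1), (1, -1), (-1, 1)} : Finset (ℤ × ℤ)),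
    u.1 * v.2 - u.2 * v.1 = 1 → (u.1, u.2, v.1, v.2) ∈ hexs := by decide

lemma wv_val {A B C : ℤ} (v : ℤ × ℤ × ℤ × ℤ) (X Y Z : ℤ)
    (hd : v.1 * v.2.2.2 - v.2.1 * v.2.2.1 = 1)
    (h1 : A * v.1 ^ 2 + B * v.1 * v.2.2.1 + C * v.2.2.1 ^ 2 = X)
    (h2 : 2 * A * v.1 * v.2.1 + B * (v.1 * v.2.2.2 + v.2.1 * v.2.2.1) + 2 * C * v.2.2.1 * v.2.2.2 = Y)
    (h3 : A * v.2.1 ^ 2 + B * v.2.1 * v.2.2.2 + C * v.2.2.2 ^ 2 = Z) :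
    wv A B C v = w2 X Y Z := by
  rw [wv, if_pos hd, h1, h2, h3]

lemma hexs_sum {A B C : ℤ} (h1 : 0 < 2 * A + B) (h2 : 0 < 2 * C + B) (h3 : B ≤ 0) :
    ∑ v ∈ hexs, wv A B C v = 12 := by
  unfold hexs
  repeat rw [Finset.sum_insert (by decide)]
  rw [Finset.sum_singleton]
  rw [wv_val (1, 0, 0, 1) A B C (by norm_num) (by ring) (by ring) (by ring),
    wv_val (-1, 0, 0, -1) A B C (by norm_num) (by ring) (by ring) (by ring),
    wv_val (0, 1, -1, 1) C (-B - 2 * C) (A + B + C) (by norm_num) (by ring) (by ring) (by ring),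
    wv_val (0, -1, 1, -1) C (-B - 2 * C) (A + B + C) (by norm_num) (by ring) (by ring) (by ring),
    wv_val (1, -1, 1, 0) (A + B + C) (-B - 2 * A) A (by norm_num) (by ring) (by ring) (by ring),
    wv_val (-1, 1, -1, 0) (A + B + C) (-B - 2 * A) A (by norm_num) (by ring) (by ring) (by ring),
    wv_val (1, 0, -1, 1) (A - B + C) (B - 2 * C) C (by norm_num) (by ring) (by ring) (by ring),
    wv_val (-1, 0, 1, -1) (A - B + C) (B - 2 * C) C (by norm_num) (by ring) (by ring) (by ring),
    wv_val (0, 1, -1, 0) C (-B) A (by norm_num) (by ring) (by ring) (by ring),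
    wv_val (0, -1, 1, 0) C (-B) A (by norm_num) (by ring) (by ring) (by ring),
    wv_val (1, -1, 0, 1) A (B - 2 * A) (A - B + C) (by norm_num) (by ring) (by ring) (by ring),
    wv_val (-1, 1, 0, -1) A (B - 2 * A) (A - B + C) (by norm_num) (by ring) (by ring) (by ring)]
  have p1 := Int.sign_eq_one_of_pos h1
  have p2 := Int.sign_eq_one_of_pos h2
  have q1 : (2 * A - B).sign = 1 := Int.sign_eq_one_of_pos (by linarith)
  have q2 : (2 * C - B).sign = 1 := Int.sign_eq_one_of_pos (by linarith)
  have n1 : (-B).sign = - B.sign := sg_neg' B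
  rw [w2_val p1 p2 n1,
    w2_val (A := C) (B := -B - 2 * C) (C := A + B + C) (x := - B.sign) (y := 1) (z := 1) (by rw [← n1]; congr 1; ring) (by rw [← p1]; congr 1; ring) (by rw [← p2]; congr 1; ring),
    w2_val (A := A + B + C) (B := -B - 2 * A) (C := A) (x := 1) (y := - B.sign) (z := 1) (by rw [← p2]; congr 1; ring) (by rw [← n1]; congr 1; ring) (by rw [← p1]; congr 1; ring),
    w2_val (A := A - B + C) (B := B - 2 * C) (C := C) (x := 1) (y := B.sign) (z := 1) (by rw [← q1]; congr 1; ring) (by congr 1; ring) (by rw [← q2]; congr 1; ring),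
    w2_val (A := C) (B := -B) (C := A) (x := 1) (y := 1) (z := B.sign) (by rw [← q2]; congr 1) (by rw [← q1]; congr 1) (by congr 1; ring),
    w2_val (A := A) (B := B - 2 * A) (C := A - B + C) (x := B.sign) (y := 1) (z := 1) (by congr 1; ring) (by rw [← q2]; congr 1; ring) (by rw [← q1]; congr 1; ring)]
  ring

lemma wF_act {N : ℤ} (hN : 0 < N) {A B C : ℤ} (hp : IsPosDef (A, B, C)) (hD : formDisc (A, B, C) = -N)
    (γ : SG) : wF N (formAct γ (A, B, C)) = wv A B C (sent γ) := by
  have h1 := formAct_pos γ _ hp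
  have h2 := formAct_disc γ (A, B, C)
  unfold wF wv
  rw [if_pos ⟨by rw [h2, hD], h1.1⟩]
  simp only [sent]
  rw [formAct_eq]
  exact (if_pos (det_eq γ)).symm

lemma red_sum {N : ℤ} (hN : 0 < N) {A B C : ℤ} (hp : IsPosDef (A, B, C)) (hD : formDisc (A, B, C) = -N)
    (h1 : 0 < 2 * A + B) (h2 : 0 < 2 * C + B) (h3 : B ≤ 0) :
    ∑ᶠ γ : SG, wF N (formAct γ (A, B, C)) = 12 := by
  rw [finsum_congr (wF_act hN hp hD), finsum_inj (wv A B C) sent sent_inj,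
    finsum_eq_sum_of_support_subset (s := hexs), hexs_sum h1 h2 h3]
  · rintro ⟨p, q, r, s⟩ hv
    have hd : p * s - q * r = 1 := by
      by_contra hd; exact hv (by simp [wv, hd])
    set γ := smk p q r s hd
    have hγ : sent γ = (p, q, r, s) := by simp [sent, γ, smk]
    have hv' : wF N (formAct γ (A, B, C)) ≠ 0 := by
      rw [wF_act hN hp hD, hγ]; exact hv
    obtain ⟨k1, k2⟩ := formAct_pos γ _ hp
    have k3 : 0 ≤ 2 * (formAct γ (A, B, C)).1 + (formAct γ (A, B, C)).2.1 ∧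
        0 ≤ 2 * (formAct γ (A, B, C)).2.2 + (formAct γ (A, B, C)).2.1 ∧ (formAct γ (A, B, C)).2.1 ≤ 0 := by
      apply w2_ne k1 k2
      unfold wF at hv'
      split_ifs at hv' with h
      · exact hv'
      · exact absurd rfl hv'
    have k4 := ftr_le k3.1 k3.2.1 k3.2.2 γ⁻¹
    rw [show ((formAct γ (A, B, C)).1, (formAct γ (A, B, C)).2.1, (formAct γ (A, B, C)).2.2) = formAct γ (A, B, C) from rfl,
      formAct_mul, mul_inv_cancel, formAct_one] at k4
    obtain ⟨e1, e2⟩ := hexa h1 h2 h3 γ k4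
    have e1' : p ^ 2 + p * q + q ^ 2 = 1 := by simpa [γ, smk] using e1
    have e2' : r ^ 2 + r * s + s ^ 2 = 1 := by simpa [γ, smk] using e2
    exact hexs_mem _ (hx1 e1') _ (hx1 e2') hd
  · rintro ⟨p, q, r, s⟩ hv
    have hd : p * s - q * r = 1 := by
      by_contra hd; exact hv (by simp [wv, hd])
    exact ⟨smk p q r s hd, by simp [sent, smk]⟩

lemma act_sum {N : ℤ} (hN : 0 < N) (Q : ℤ × ℤ × ℤ) (hp : IsPosDef Q) (hD : formDisc Q = -N) :
    ∑ᶠ γ : SG, wF N (formAct γ Q) = 12 := by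
  obtain ⟨δ, A, B, C, h, h1, h2, h3⟩ := exists_red Q hp
  rw [← red_sum hN (h ▸ formAct_pos δ Q hp) (by rw [← h, formAct_disc, hD]) h1 h2 h3, ← h,
    ← finsum_comp_equiv (Equiv.mulLeft δ)]
  apply finsum_congr
  intro γ
  rw [formAct_mul]; rfl

lemma card_fib (Q : ℤ × ℤ × ℤ) (δ : SG) :
    Nat.card {γ : SG // formAct γ Q = formAct δ Q} = Nat.card {γ : SG // formAct γ Q = Q} := by
  apply Nat.card_congr
  refine (Equiv.mulRight δ⁻¹).subtypeEquiv ?_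
  intro γ
  simp only [Equiv.coe_mulRight]
  rw [← formAct_mul]
  constructor
  · intro h; rw [h, formAct_mul, mul_inv_cancel, formAct_one]
  · intro h; nth_rewrite 2 [← h]; rw [formAct_mul, formAct_mul]; simp

open Classical in
lemma orbit_sum {N : ℤ} (hN : 0 < N) (Q : ℤ × ℤ × ℤ) (hp : IsPosDef Q) (hD : formDisc Q = -N) :
    (∑ F ∈ (wF_fin hN).toFinset, if ∃ γ : SG, formAct γ Q = F then wF N F else 0) *
      (Nat.card {γ : SG // formAct γ Q = Q} : ℤ) = 12 := by
  have h := act_sum hN Q hp hD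
  have hfin : (Function.support (fun γ : SG => wF N (formAct γ Q))).Finite := by
    by_contra hc
    rw [finsum_of_infinite_support hc] at h
    norm_num at h
  rw [finsum_eq_sum _ hfin, ← Finset.sum_fiberwise_of_maps_to (t := (wF_fin hN).toFinset)
    (g := fun γ : SG => formAct γ Q)] at h
  · rw [← h, Finset.sum_mul]
    apply Finset.sum_congr rfl
    intro F hF
    rw [Set.Finite.mem_toFinset, Function.mem_support] at hF
    rw [Finset.sum_congr rfl (g := fun _ => wF N F) (by
      intro γ hγ; rw [(Finset.mem_filter.mp hγ).2]), Finset.sum_const, nsmul_eq_mul]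
    have key : Nat.card {γ : SG // formAct γ Q = F} = (hfin.toFinset.filter (fun γ => formAct γ Q = F)).card := by
      apply Nat.subtype_card
      intro γ
      rw [Finset.mem_filter, Set.Finite.mem_toFinset, Function.mem_support]
      constructor
      · exact fun h => h.2
      · intro h; rw [h]; exact ⟨hF, rfl⟩
    rw [← key]
    split_ifs with hex
    · obtain ⟨δ, rfl⟩ := hex
      rw [card_fib]; ring
    · have : IsEmpty {γ : SG // formAct γ Q = F} := ⟨fun γ => hex ⟨γ.1, γ.2⟩⟩
      simp
  · intro γ hγ
    simpa using hγ


lemma cls_iff {N : ℤ} (c : FormClasses N) (F : {Q : ℤ × ℤ × ℤ // formDisc Q = -N ∧ IsPosDef Q}) :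
    (∃ γ : SG, formAct γ c.out.1 = F.1) ↔ c = Quot.mk _ F := by
  constructor
  · intro h
    rw [← Quot.out_eq c]
    exact Quot.sound h
  · intro h
    have h2 : Quot.mk (fun (Q Q' : {Q : ℤ × ℤ × ℤ // formDisc Q = -N ∧ IsPosDef Q}) =>
      ∃ γ : SG, formAct γ Q.1 = Q'.1) c.out = Quot.mk _ F := by
      rw [Quot.out_eq, h]
    have h3 := Quot.eqvGen_exact h2
    have heq : Equivalence (fun (Q Q' : {Q : ℤ × ℤ × ℤ // formDisc Q = -N ∧ IsPosDef Q}) =>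
      ∃ γ : SG, formAct γ Q.1 = Q'.1) := by
      refine ⟨fun Q => ⟨1, formAct_one _⟩, ?_, ?_⟩
      · rintro Q Q' ⟨γ, h⟩
        exact ⟨γ⁻¹, by rw [← h, formAct_mul, mul_inv_cancel, formAct_one]⟩
      · rintro Q Q' Q'' ⟨γ, h⟩ ⟨δ, h'⟩
        exact ⟨γ * δ, by rw [← formAct_mul, h, h']⟩
    exact heq.eqvGen_iff.mp h3

theorem wF_H {N : ℤ} (hN : 0 < N) : ((∑ᶠ Q, wF N Q : ℤ) : ℝ) = 6 * hurwitzClassNumber N := by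
  classical
  unfold hurwitzClassNumber
  rw [if_neg hN.ne', ← smul_eq_mul, smul_finsum]
  have e1 : ∀ c : FormClasses N, (6 : ℝ) • ((2 : ℝ) / (Nat.card {γ : SG //
      formAct γ c.out.1 = c.out.1})) =
      ∑ F ∈ (wF_fin hN).toFinset, if ∃ γ : SG, formAct γ c.out.1 = F then (wF N F : ℝ) else 0 := by
    intro c
    have h := orbit_sum hN c.out.1 c.out.2.2 c.out.2.1
    have h' : ((∑ F ∈ (wF_fin hN).toFinset, if ∃ γ : SG, formAct γ c.out.1 = F then (wF N F : ℝ) else 0)) *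
      (Nat.card {γ : SG // formAct γ c.out.1 = c.out.1} : ℝ) = 12 := by
      have h2 := congrArg (fun z : ℤ => (z : ℝ)) h
      push_cast at h2
      exact h2
    have h0 : (Nat.card {γ : SG // formAct γ c.out.1 = c.out.1} : ℝ) ≠ 0 := by
      intro h0; rw [h0] at h'; norm_num at h'
    rw [smul_eq_mul, ← mul_div_assoc, div_eq_iff h0, h']; norm_num
  rw [finsum_congr e1, finsum_sum_comm, finsum_eq_sum _ (wF_fin hN)]
  · push_cast
    apply Finset.sum_congr rfl
    intro F hF
    rw [Set.Finite.mem_toFinset, Function.mem_support] at hF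
    have hF' : formDisc F = -N ∧ IsPosDef F := by
      unfold wF at hF
      split_ifs at hF with h
      · exact ⟨h.1, h.2, by rw [h.1]; linarith⟩
      · exact absurd rfl hF
    rw [finsum_eq_single _ (Quot.mk _ ⟨F, hF'⟩)]
    · rw [if_pos]; exact (cls_iff _ ⟨F, hF'⟩).mpr rfl
    · intro c hc
      rw [if_neg]
      intro h; exact hc ((cls_iff c ⟨F, hF'⟩).mp h)
  · intro F hF
    rw [Set.Finite.mem_toFinset, Function.mem_support] at hF
    have hF' : formDisc F = -N ∧ IsPosDef F := by
      unfold wF at hF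
      split_ifs at hF with h
      · exact ⟨h.1, h.2, by rw [h.1]; linarith⟩
      · exact absurd rfl hF
    refine (Set.finite_singleton (Quot.mk _ ⟨F, hF'⟩)).subset ?_
    intro c hc
    rw [Function.mem_support] at hc
    by_contra h
    apply hc
    rw [if_neg]
    intro h'
    exact h ((cls_iff c ⟨F, hF'⟩).mp h')

lemma H_neg {N : ℤ} (hN : N < 0) : hurwitzClassNumber N = 0 := by
  unfold hurwitzClassNumber
  rw [if_neg hN.ne]
  have : IsEmpty (FormClasses N) := ⟨fun c => by
    have h := c.out.2
    have h1 := h.1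
    have h2 := h.2.2
    omega⟩
  exact finsum_of_isEmpty _

lemma tau_neg (t : ℤ) : tau (-t) = tau t := by
  unfold tau; push_cast; simp

lemma tau_mod (t : ℤ) : tau t = if t % 3 = 0 then 0 else 1 := by
  unfold tau
  have : ((t : ZMod 3) = 0) ↔ t % 3 = 0 := by
    rw [show (t : ZMod 3) = 0 ↔ (3 : ℤ) ∣ t from ZMod.intCast_zmod_eq_zero_iff_dvd t 3]
    omega
  rw [if_congr this rfl rfl]

lemma fin_t (n : ℤ) (f : ℤ → ℝ) (h : ∀ t, 4 * n < t ^ 2 → f t = 0) : (Function.support f).Finite := by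
  refine (Set.finite_Icc (-(4 * |n|)) (4 * |n|)).subset ?_
  intro t ht
  rw [Function.mem_support] at ht
  have h1 : t ^ 2 ≤ 4 * n := by
    by_contra hc; exact ht (h t (by linarith))
  have h2 := le_abs_self n
  have h3 : |t| ≤ 4 * |n| := by
    have : |t| ≤ |t| ^ 2 := by
      rcases (abs_nonneg t).eq_or_lt with h | h
      · rw [← h]; norm_num
      · nlinarith
    rw [sq_abs] at this
    linarith
  exact abs_le.mp h3

lemma HH_symm (n : ℕ) : HH 0 1 3 n = HH 0 2 3 n := by
  unfold HH
  rw [← finsum_comp_equiv (Equiv.neg ℤ)]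
  apply finsum_congr
  intro t
  simp only [Equiv.neg_apply, pow_zero, neg_sq]
  apply if_congr _ rfl rfl
  push_cast
  omega

lemma HH_sum (n : ℕ) : HH 0 1 3 n + HH 0 2 3 n =
    ∑ᶠ t : ℤ, (tau t : ℝ) * hurwitzClassNumber (4 * n - t ^ 2) := by
  unfold HH
  rw [← finsum_add_distrib]
  · apply finsum_congr
    intro t
    rw [tau_mod]
    have : t % 3 = 0 ∨ t % 3 = 1 ∨ t % 3 = 2 := by omega
    rcases this with h | h | h <;> simp [h]
  all_goals
    apply fin_t n
    intro t ht
    rw [H_neg (by linarith)]; simp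

/-- trace formula -/
lemma final_eq (n : ℕ) (hn : 0 < n) :
    ((Sm n (fun a b c d => tau (a + d) * root2 a b c d) : ℤ) : ℝ) =
    12 * (HH 0 1 3 n + HH 0 2 3 n) -
      ((3 * ∑ p ∈ Int.divisorsAntidiag n, tau (p.1 + p.2) * |p.1 - p.2| : ℤ) : ℝ) := by
  have hn' : (0 : ℤ) < n := by exact_mod_cast hn
  rw [split hn', HH_sum, ← smul_eq_mul (12 : ℝ), smul_finsum]
  have hcusp : (∑ p ∈ Int.divisorsAntidiag (n : ℤ), tau (p.1 + p.2) *
        (3 * |p.1 - p.2| + if p.1 = p.2 then 1 else 0)) =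
      3 * (∑ p ∈ Int.divisorsAntidiag (n : ℤ), tau (p.1 + p.2) * |p.1 - p.2|) +
      ∑ᶠ t : ℤ, if t ^ 2 = 4 * n then tau t else 0 := by
    rw [Finset.mul_sum]
    have : ∑ᶠ t : ℤ, (if t ^ 2 = 4 * n then tau t else 0) =
       ∑ p ∈ Int.divisorsAntidiag (n : ℤ), if p.1 = p.2 then tau (p.1 + p.2) else 0 := by
      rw [← Finset.sum_filter]
      have hs : Function.support (fun t : ℤ => if t ^ 2 = 4 * n then tau t else 0) ⊆
          ((Int.divisorsAntidiag (n : ℤ)).filter (fun p => p.1 = p.2)).image (fun p => p.1 + p.2) := by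
        intro t ht
        rw [Function.mem_support] at ht
        split_ifs at ht with h
        · have he : Even t := by
            have : Even (t ^ 2) := ⟨2 * n, by linarith⟩
            exact (Int.even_pow' two_ne_zero).mp this
          obtain ⟨a, rfl⟩ := he
          rw [Finset.mem_coe, Finset.mem_image]
          refine ⟨(a, a), ?_, rfl⟩
          rw [Finset.mem_filter, Int.mem_divisorsAntidiag]
          exact ⟨⟨by linarith, hn'.ne'⟩, rfl⟩
        · exact absurd rfl ht
      rw [finsum_eq_sum_of_support_subset _ hs, Finset.sum_image]
      · apply Finset.sum_congr rfl
        rintro ⟨a, d⟩ hp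
        rw [Finset.mem_filter, Int.mem_divisorsAntidiag] at hp
        obtain ⟨⟨h1, _⟩, h2⟩ := hp
        simp only at h1 h2
        subst h2
        rw [if_pos]
        simp only
        linarith
      · rintro ⟨a, d⟩ hp ⟨a', d'⟩ hp' h
        have h1 := (Finset.mem_filter.mp hp).2
        have h2 := (Finset.mem_filter.mp hp').2
        simp only [Prod.mk.injEq] at *
        omega
    rw [this, ← Finset.sum_add_distrib]
    apply Finset.sum_congr rfl
    intro p _
    split_ifs <;> ring
  rw [hcusp]
  have key : ∀ t : ℤ, (12 : ℝ) • ((tau t : ℝ) * hurwitzClassNumber (4 * n - t ^ 2)) =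
      (((if t ^ 2 < 4 * (n : ℤ) then tau t * (2 * ∑ᶠ Q, wF (4 * n - t ^ 2) Q) else 0) -
        (if t ^ 2 = 4 * (n : ℤ) then tau t else 0) : ℤ) : ℝ) := by
    intro t
    rcases lt_trichotomy (t ^ 2) (4 * (n : ℤ)) with h | h | h
    · rw [if_pos h, if_neg h.ne]
      push_cast
      rw [wF_H (by linarith), smul_eq_mul]; ring
    · rw [if_neg h.not_lt, if_pos h, h, sub_self]
      unfold hurwitzClassNumber
      rw [if_pos rfl, smul_eq_mul]; push_cast; ring
    · rw [if_neg h.not_gt, if_neg h.ne', H_neg (by linarith)]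
      simp
  have s1 : (Function.support (fun t : ℤ => if t ^ 2 < 4 * (n : ℤ) then tau t * (2 * ∑ᶠ Q, wF (4 * n - t ^ 2) Q) else 0)).Finite := by
    have := fin_t n (fun t => ((if t ^ 2 < 4 * (n : ℤ) then tau t * (2 * ∑ᶠ Q, wF (4 * n - t ^ 2) Q) else 0 : ℤ) : ℝ))
      (by intro t ht; rw [if_neg ht.not_gt]; simp)
    refine this.subset ?_
    intro t ht
    rw [Function.mem_support] at *
    exact_mod_cast ht
  have s2 : (Function.support (fun t : ℤ => if t ^ 2 = 4 * (n : ℤ) then tau t else 0)).Finite := by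
    have := fin_t n (fun t => ((if t ^ 2 = 4 * (n : ℤ) then tau t else 0 : ℤ) : ℝ))
      (by intro t ht; rw [if_neg ht.ne']; simp)
    refine this.subset ?_
    intro t ht
    rw [Function.mem_support] at *
    exact_mod_cast ht
  have hm := finsum_sub_distrib s1 s2
  have hc : (((∑ᶠ t : ℤ, ((if t ^ 2 < 4 * (n : ℤ) then tau t * (2 * ∑ᶠ Q, wF (4 * n - t ^ 2) Q) else 0) -
        (if t ^ 2 = 4 * (n : ℤ) then tau t else 0)) : ℤ)) : ℝ) =
     ∑ᶠ t : ℤ, (((if t ^ 2 < 4 * (n : ℤ) then tau t * (2 * ∑ᶠ Q, wF (4 * n - t ^ 2) Q) else 0) -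
        (if t ^ 2 = 4 * (n : ℤ) then tau t else 0) : ℤ) : ℝ) :=
    (Int.castAddHom ℝ).map_finsum ((s1.union s2).subset (Function.support_sub _ _))
  rw [finsum_congr key, ← hc, hm]
  push_cast
  ring

def mnn (n : ℕ) : ℕ := ∑ d ∈ n.divisors, min d (n / d)

lemma abs_min (n : ℕ) : ∑ d ∈ n.divisors, (|(d : ℤ) - (n / d : ℕ)| : ℤ) =
    2 * sgm n - 2 * (mnn n : ℤ) := by
  have h1 := sgm' n
  have : ∀ d ∈ n.divisors, (|(d : ℤ) - (n / d : ℕ)| : ℤ) =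
     (d : ℤ) + (n / d : ℕ) - 2 * (min d (n / d) : ℕ) := by
    intro d _
    rcases le_total d (n / d) with h | h
    · rw [min_eq_left h, abs_of_nonpos (by omega)]; ring
    · rw [min_eq_right h, abs_of_nonneg (by omega)]; ring
  rw [Finset.sum_congr rfl this, Finset.sum_sub_distrib, Finset.sum_add_distrib, h1, ← Finset.mul_sum]
  unfold sgm mnn
  push_cast
  ring

lemma cusp1 (n : ℕ) (h : n % 3 = 1) :
    ∑ p ∈ Int.divisorsAntidiag n, tau (p.1 + p.2) * |p.1 - p.2| =
      4 * (sgm n - (mnn n : ℤ)) := by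
  rw [sum_antidiag n (fun a b => tau (a + b) * |a - b|)]
  have : ∀ d ∈ n.divisors, (tau ((d : ℤ) + (n / d : ℕ)) * |(d : ℤ) - (n / d : ℕ)| +
      tau (-(d : ℤ) + -((n / d : ℕ) : ℤ)) * |-(d : ℤ) - -((n / d : ℕ) : ℤ)|) = 2 * |(d : ℤ) - (n / d : ℕ)| := by
    intro d hd
    have hm := Nat.mul_div_cancel' (Nat.dvd_of_mem_divisors hd)
    have ht : tau ((d : ℤ) + (n / d : ℕ)) = 1 := by
      rw [tau_mod, if_neg]
      intro hc
      have h3 : (d + n / d) % 3 = 0 := by omega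
      have h4 : (d * (n / d)) % 3 = 1 := by rw [hm, h]
      rw [Nat.mul_mod] at h4
      have : d % 3 = 0 ∨ d % 3 = 1 ∨ d % 3 = 2 := by omega
      rcases this with h5 | h5 | h5 <;> rw [h5] at h4
      · simp at h4
      · have : (n / d) % 3 = 2 := by omega
        rw [this] at h4; norm_num at h4
      · have : (n / d) % 3 = 1 := by omega
        rw [this] at h4; norm_num at h4
    rw [← neg_add, tau_neg, ht, ← neg_sub', abs_neg]; ring
  rw [Finset.sum_congr rfl this, ← Finset.mul_sum, abs_min]; ring

lemma cusp2 (n : ℕ) (h : n % 3 = 2) :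
    ∑ p ∈ Int.divisorsAntidiag n, tau (p.1 + p.2) * |p.1 - p.2| = 0 := by
  rw [sum_antidiag n (fun a b => tau (a + b) * |a - b|)]
  apply Finset.sum_eq_zero
  intro d hd
  have hm := Nat.mul_div_cancel' (Nat.dvd_of_mem_divisors hd)
  have ht : tau ((d : ℤ) + (n / d : ℕ)) = 0 := by
    rw [tau_mod, if_pos]
    have h4 : (d * (n / d)) % 3 = 2 := by rw [hm, h]
    rw [Nat.mul_mod] at h4
    have : d % 3 = 0 ∨ d % 3 = 1 ∨ d % 3 = 2 := by omega
    have : (n / d) % 3 = 0 ∨ (n / d) % 3 = 1 ∨ (n / d) % 3 = 2 := by omega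
    have : (d + n / d) % 3 = 0 := by
      rcases this with h6 | h6 | h6 <;> rcases ‹d % 3 = 0 ∨ _› with h5 | h5 | h5 <;>
        rw [h5, h6] at h4 <;> omega
    omega
  rw [← neg_add, tau_neg, ht]; ring

lemma min_cast (n : ℕ) : ∑ d ∈ n.divisors, (min d (n / d) : ℝ) =
    (mnn n : ℝ) := by
  unfold mnn
  push_cast
  apply Finset.sum_congr rfl
  intro d hd
  rw [Nat.cast_div_charZero (Nat.dvd_of_mem_divisors hd)]

/-- Lemma 4.1 (2): for `3 ∤ n`, `H_{1,3}(n) = H_{2,3}(n)`, and this common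
value equals `(3/4)σ(n) - (1/2)∑_{d∣n} min(d, n/d)` if `n ≡ 1 (mod 3)`, and
`σ(n)/2` if `n ≡ 2 (mod 3)`. -/
theorem class_number_sum_m_nonzero (n : ℕ) (hn : 0 < n) (h3 : ¬ 3 ∣ n) :
    HH 0 1 3 n = HH 0 2 3 n
    ∧ (n % 3 = 1 → HH 0 1 3 n =
        3 / 4 * (∑ d ∈ n.divisors, (d : ℝ))
          - 1 / 2 * ∑ d ∈ n.divisors, (min d (n / d) : ℝ))
    ∧ (n % 3 = 2 → HH 0 1 3 n = (∑ d ∈ n.divisors, (d : ℝ)) / 2) := by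
  have hs := HH_symm n
  have hf := final_eq n hn
  have hsg : (∑ d ∈ n.divisors, (d : ℝ)) = ((sgm n : ℤ) : ℝ) := by unfold sgm; push_cast; rfl
  refine ⟨hs, ?_, ?_⟩
  · intro h
    rw [main1 n hn h, cusp1 n h, ← hs] at hf
    rw [hsg, min_cast]
    push_cast at hf ⊢
    linarith
  · intro h
    rw [main2 n hn h, cusp2 n h, ← hs] at hf
    rw [hsg]
    push_cast at hf ⊢
    linarith

end HurwitzPaper
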